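/- arXiv:hep-th/0101063 — 7 statements merged into one kernel-verified Lean document; each statement's English description precedes it below -/
import Mathlib

section
/- Let 1 ≤ p < ∞ and let f be Hardy class from below of order p. Then for every z ∈ ℂ with Im z < 0 one has f(z) = −(1/(2πi)) ∫_ℝ f(t)/(t − z) dt, where the integral is over the boundary values of f on the real axis. (Titchmarsh theorem, representation part, lower half-plane.) -/
open MeasureTheory Filter

/-- `f : ℂ → ℂ` is Hardy class from below of order `p`: analytic on the open lower
half-plane, continuous on the closed lower half-plane, and the `L^p` norms of the
horizontal sections `x ↦ f (x + iy)`, `y < 0`, are uniformly bounded. -/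
def HardyBelow (p : ℝ) (f : ℂ → ℂ) : Prop :=
  DifferentiableOn ℂ f {z : ℂ | z.im < 0} ∧
  ContinuousOn f {z : ℂ | z.im ≤ 0} ∧
  ∃ M : ℝ, ∀ y : ℝ, y < 0 →
    Integrable (fun x : ℝ => ‖f (↑x + ↑y * Complex.I)‖ ^ p) ∧
    ∫ x : ℝ, ‖f (↑x + ↑y * Complex.I)‖ ^ p ≤ M

open Complex Set Topology in
/-- Cauchy's theorem on a horizontal strip: a function holomorphic there whose horizontal sections
are bounded in `L¹` has the same integral along both edges. -/
theorem integral_horizontal_eq_of_integral_norm_le {G : ℂ → ℂ} {Y B : ℝ} (hY : Y ≤ 0)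
    (hc : ContinuousOn G {z : ℂ | z.im ≤ 0}) (hd : DifferentiableOn ℂ G {z : ℂ | z.im < 0})
    (hint : ∀ y ∈ Icc Y 0, Integrable fun x : ℝ => G (x + y * I))
    (hB : ∀ y ∈ Icc Y 0, ∫ x : ℝ, ‖G (x + y * I)‖ ≤ B) :
    ∫ x : ℝ, G (x + Y * I) = ∫ x : ℝ, G x := by
  set S : ℝ → ℂ := fun b => ∫ y in Y..0, G (b + y * I) with hS
  have hmeas : AEStronglyMeasurable (fun q : ℝ × ℝ => G (q.1 + q.2 * I))
      (volume.prod (volume.restrict (Ioc Y 0))) := by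
    have h : ContinuousOn (fun q : ℝ × ℝ => G (q.1 + q.2 * I)) (univ ×ˢ Ioc Y 0) := by
      refine hc.comp (by fun_prop) ?_
      rintro ⟨a, b⟩ hab
      simpa using hab.2.2
    have := h.aestronglyMeasurable (μ := volume.prod volume)
      (MeasurableSet.univ.prod measurableSet_Ioc)
    rwa [← Measure.prod_restrict, Measure.restrict_univ] at this
  have hprod : Integrable (fun q : ℝ × ℝ => G (q.1 + q.2 * I))
      (volume.prod (volume.restrict (Ioc Y 0))) := by
    rw [integrable_prod_iff' hmeas]
    refine ⟨?_, ?_⟩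
    · filter_upwards [ae_restrict_mem measurableSet_Ioc] with y hy
      exact hint y (Ioc_subset_Icc_self hy)
    · refine Integrable.of_bound (hmeas.prod_swap.norm.integral_prod_right') B ?_
      filter_upwards [ae_restrict_mem measurableSet_Ioc] with y hy
      rw [Real.norm_of_nonneg (integral_nonneg fun _ => norm_nonneg _)]
      exact hB y (Ioc_subset_Icc_self hy)
  have hSint : Integrable S := by
    simpa only [hS, intervalIntegral.integral_of_le hY] using hprod.integral_prod_left
  have hrect : ∀ b : ℝ, 0 ≤ b → (∫ x in (-b)..b, G (x + Y * I)) - (∫ x in (-b)..b, G x)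
      = -I * (S b - S (-b)) := by
    intro b hb
    have := integral_boundary_rect_eq_zero_of_continuousOn_of_differentiableOn G
      (-b + Y * I) b (hc.mono ?_) (hd.mono ?_)
    · simp only [add_re, neg_re, ofReal_re, mul_re, I_re, mul_zero, ofReal_im, I_im, mul_one,
        sub_self, add_zero, add_im, neg_im, neg_zero, mul_im, zero_add, ofReal_zero, zero_mul,
        smul_eq_mul, ofReal_neg] at this
      simp only [hS, ofReal_neg]
      linear_combination this
    · rintro w ⟨-, hw⟩
      simp [uIcc_of_le hY] at hw
      exact hw.2
    · rintro w ⟨-, hw⟩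
      simp [hY] at hw
      exact hw.2
  have h0 : Integrable fun x : ℝ => G x := by simpa using hint 0 ⟨hY, le_rfl⟩
  have hlim : Tendsto (fun b : ℝ => -I * (S b - S (-b))) atTop
      (𝓝 ((∫ x : ℝ, G (x + Y * I)) - ∫ x : ℝ, G x)) := by
    refine ((intervalIntegral_tendsto_integral (hint Y ⟨le_rfl, hY⟩) tendsto_neg_atTop_atBot
      tendsto_id).sub (intervalIntegral_tendsto_integral h0 tendsto_neg_atTop_atBot
      tendsto_id)).congr' ?_
    filter_upwards [eventually_ge_atTop 0] with b hb using hrect b hb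
  have hi : Integrable fun b : ℝ => -I * (S b - S (-b)) :=
    (hSint.sub hSint.comp_neg).const_mul _
  refine sub_eq_zero.1 ((hi.integrableAtFilter atTop).eq_zero_of_tendsto (fun s hs => ?_) hlim)
  obtain ⟨b, hb⟩ := mem_atTop_sets.1 hs
  rw [← top_le_iff, ← Real.volume_Ici (a := b)]
  exact measure_mono hb

open Complex Set Topology in
/-- A function holomorphic in the lower half-plane and decaying like `(1 + u z) / (1 + ‖z‖) ^ 2`,
with `u` bounded in `L¹` on horizontal lines, has integral zero over the real line. -/
theorem integral_real_eq_zero_of_norm_le {G : ℂ → ℂ} {u : ℂ → ℝ} {C M : ℝ} (hC : 0 ≤ C)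
    (hc : ContinuousOn G {z : ℂ | z.im ≤ 0}) (hd : DifferentiableOn ℂ G {z : ℂ | z.im < 0})
    (hu : ∀ z, 0 ≤ u z)
    (huI : ∀ y : ℝ, y ≤ 0 → Integrable fun x : ℝ => u (x + y * I))
    (huM : ∀ y : ℝ, y ≤ 0 → ∫ x : ℝ, u (x + y * I) ≤ M)
    (hG : ∀ z : ℂ, z.im ≤ 0 → ‖G z‖ ≤ C * ((1 + u z) / (1 + ‖z‖) ^ 2)) :
    (Integrable fun x : ℝ => G x) ∧ ∫ x : ℝ, G x = 0 := by
  set J : ℝ → ℝ := fun y => ∫ x : ℝ, (1 + x ^ 2 + y ^ 2)⁻¹ with hJ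
  have hinv (x y : ℝ) : (1 + x ^ 2 + y ^ 2)⁻¹ ≤ (1 + x ^ 2)⁻¹ := 
    inv_anti₀ (by positivity) (by nlinarith [sq_nonneg y])
  have hJmeas (y : ℝ) : AEStronglyMeasurable (fun x : ℝ => (1 + x ^ 2 + y ^ 2)⁻¹) :=
    Measurable.aestronglyMeasurable (by fun_prop)
  have hJint (y : ℝ) : Integrable fun x : ℝ => (1 + x ^ 2 + y ^ 2)⁻¹ := by
    refine integrable_inv_one_add_sq.mono' (hJmeas y) (ae_of_all _ fun x => ?_)
    rw [Real.norm_of_nonneg (by positivity)]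
    exact hinv x y
  have hbd : ∀ y : ℝ, y ≤ 0 → ∀ x : ℝ, ‖G (x + y * I)‖ ≤
      C * ((1 + x ^ 2 + y ^ 2)⁻¹ + u (x + y * I) * (1 + y ^ 2)⁻¹) := by
    intro y hy x
    refine (hG _ (by simpa using hy)).trans ?_
    have hn : 1 + x ^ 2 + y ^ 2 ≤ (1 + ‖(x + y * I : ℂ)‖) ^ 2 := by
      have h1 : ‖(x + y * I : ℂ)‖ ^ 2 = x ^ 2 + y ^ 2 := by
        rw [← normSq_eq_norm_sq, normSq_add_mul_I]
      nlinarith [norm_nonneg (x + y * I : ℂ)]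
    have hu' := hu (x + y * I)
    rw [add_div, one_div, div_eq_mul_inv]
    gcongr
    nlinarith [sq_nonneg x]
  have hbdI (y : ℝ) (hy : y ≤ 0) : Integrable fun x : ℝ =>
      C * ((1 + x ^ 2 + y ^ 2)⁻¹ + u (x + y * I) * (1 + y ^ 2)⁻¹) :=
    ((hJint y).add ((huI y hy).mul_const _)).const_mul C
  have hint (y : ℝ) (hy : y ≤ 0) : Integrable fun x : ℝ => G (x + y * I) := by
    refine (hbdI y hy).mono' ?_ (ae_of_all _ (hbd y hy))
    exact (hc.comp_continuous (by fun_prop) (by simpa using hy)).aestronglyMeasurable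
  have hle (y : ℝ) (hy : y ≤ 0) :
      ∫ x : ℝ, ‖G (x + y * I)‖ ≤ C * (J y + M * (1 + y ^ 2)⁻¹) := by
    refine (integral_mono (hint y hy).norm (hbdI y hy) (hbd y hy)).trans ?_
    rw [integral_const_mul, integral_add (hJint y) ((huI y hy).mul_const _), integral_mul_const]
    gcongr
    exact huM y hy
  have hM : 0 ≤ M := (integral_nonneg fun _ => hu _).trans (huM 0 le_rfl)
  have hle' (y : ℝ) (hy : y ≤ 0) : ∫ x : ℝ, ‖G (x + y * I)‖ ≤ C * (Real.pi + M) := by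
    refine (hle y hy).trans ?_
    have h1 : J y ≤ Real.pi := by
      rw [← integral_univ_inv_one_add_sq]
      exact integral_mono (hJint y) integrable_inv_one_add_sq fun x => hinv x y
    have h2 : M * (1 + y ^ 2)⁻¹ ≤ M :=
      mul_le_of_le_one_right hM (inv_le_one_of_one_le₀ (by nlinarith [sq_nonneg y]))
    gcongr
  have hsq : Tendsto (fun y : ℝ => y ^ 2) atBot atTop := by
    simpa [Function.comp_def] using (tendsto_pow_atTop (α := ℝ) two_ne_zero).comp
      (tendsto_abs_atBot_atTop (G := ℝ))
  have hJlim : Tendsto J atBot (𝓝 0) := by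
    have := tendsto_integral_filter_of_dominated_convergence (μ := volume) (l := atBot)
      (F := fun (y : ℝ) (x : ℝ) => (1 + x ^ 2 + y ^ 2)⁻¹) (f := fun _ => 0)
      (fun x : ℝ => (1 + x ^ 2)⁻¹) (Eventually.of_forall hJmeas)
      (Eventually.of_forall fun y => ae_of_all _ fun x => ?_) integrable_inv_one_add_sq
      (ae_of_all _ fun x => ?_)
    · simpa using this
    · rw [Real.norm_of_nonneg (by positivity)]
      exact hinv x y
    · exact (tendsto_atTop_add_const_left _ _ hsq).inv_tendsto_atTop
  have hlim : Tendsto (fun y : ℝ => C * (J y + M * (1 + y ^ 2)⁻¹)) atBot (𝓝 0) := by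
    have h1 : Tendsto (fun y : ℝ => (1 + y ^ 2)⁻¹) atBot (𝓝 0) :=
      (tendsto_atTop_add_const_left _ _ hsq).inv_tendsto_atTop
    simpa using (hJlim.add (h1.const_mul M)).const_mul C
  refine ⟨by simpa using hint 0 le_rfl, ?_⟩
  rw [← norm_le_zero_iff]
  refine ge_of_tendsto hlim ?_
  filter_upwards [eventually_le_atBot 0] with y hy
  rw [← integral_horizontal_eq_of_integral_norm_le hy hc hd (fun t ht => hint t ht.2)
    (fun t ht => hle' t ht.2)]
  exact (norm_integral_le_integral_norm _).trans (hle y hy)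

theorem one_add_norm_le_mul_norm_sub {E : Type*} [SeminormedAddCommGroup E] {r : ℝ} (hr : 0 < r)
    {v w : E} (h : r ≤ ‖v - w‖) : 1 + ‖v‖ ≤ ((1 + ‖w‖) / r + 1) * ‖v - w‖ := by
  have h1 : 1 + ‖w‖ ≤ (1 + ‖w‖) / r * ‖v - w‖ := by
    rw [div_mul_eq_mul_div, le_div_iff₀ hr]
    gcongr
  have h2 : ‖v‖ ≤ ‖w‖ + ‖v - w‖ := by
    simpa using norm_add_le w (v - w)
  linarith

theorem inv_norm_sub_le {E : Type*} [SeminormedAddCommGroup E] {r : ℝ} (hr : 0 < r)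
    {v w : E} (h : r ≤ ‖v - w‖) : ‖v - w‖⁻¹ ≤ ((1 + ‖w‖) / r + 1) / (1 + ‖v‖) := by
  rw [inv_eq_one_div, div_le_div_iff₀ (hr.trans_le h) (by positivity), one_mul]
  exact one_add_norm_le_mul_norm_sub hr h

open Complex in
theorem im_le_norm_sub {v w : ℂ} (hv : v.im ≤ 0) : w.im ≤ ‖v - w‖ := by
  have := (neg_le_abs _).trans (abs_im_le_norm (v - w))
  rw [sub_im] at this
  linarith

open Complex ComplexConjugate in
/-- The total mass of the Poisson kernel of the lower half-plane. -/
theorem integral_poisson_kernel {z : ℂ} (hz : z.im < 0) :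
    (Integrable fun t : ℝ => (z - conj z) / (t - conj z) / (t - z)) ∧
      ∫ t : ℝ, (z - conj z) / (t - conj z) / (t - z) = -(2 * Real.pi * I) := by
  set g : ℝ → ℝ := fun s => (1 + s ^ 2)⁻¹ with hg
  have hb : -z.im ≠ 0 := by linarith
  have hfun : (fun t : ℝ => (z - conj z) / (t - conj z) / (t - z)) =
      fun t : ℝ => (2 * I / z.im) * ((g ((t - z.re) / (-z.im)) : ℝ) : ℂ) := by
    ext t
    have h1 : ((t : ℂ) - conj z) * (t - z) = (((t - z.re) ^ 2 + z.im ^ 2 : ℝ) : ℂ) := by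
      conv_lhs => rw [← re_add_im z]
      simp only [map_add, map_mul, conj_ofReal, conj_I]
      push_cast
      linear_combination (-(z.im : ℂ) ^ 2) * I_sq
    have h2 : z - conj z = 2 * z.im * I := by
      rw [sub_conj]; push_cast; ring
    have h3 : (((t - z.re) ^ 2 + z.im ^ 2 : ℝ) : ℂ) ≠ 0 := by
      rw [ofReal_ne_zero]
      have := sq_pos_of_neg hz
      positivity
    have h4 : (z.im : ℂ) ≠ 0 := by simpa using hz.ne
    have h5 : g ((t - z.re) / (-z.im)) = z.im ^ 2 / ((t - z.re) ^ 2 + z.im ^ 2) := by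
      have : z.im ≠ 0 := hz.ne
      have := sq_pos_of_neg hz
      have h6 : (t - z.re) ^ 2 + z.im ^ 2 ≠ 0 := by positivity
      have h7 : z.im ^ 2 + (t - z.re) ^ 2 ≠ 0 := by positivity
      simp only [hg]
      field_simp
      ring
    rw [div_div, h1, h2, h5, ofReal_div]
    field_simp
    push_cast
    ring
  have hgi : Integrable fun t : ℝ => g ((t - z.re) / (-z.im)) :=
    (integrable_inv_one_add_sq.comp_div hb).comp_sub_right z.re
  rw [hfun]
  refine ⟨hgi.ofReal.const_mul _, ?_⟩
  rw [integral_const_mul, integral_complex_ofReal,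
    integral_sub_right_eq_self (fun t : ℝ => g (t / (-z.im))) z.re, Measure.integral_comp_div,
    hg, integral_univ_inv_one_add_sq, abs_of_pos (by linarith)]
  have h4 : (z.im : ℂ) ≠ 0 := by simpa using hz.ne
  simp only [smul_eq_mul]
  push_cast
  field_simp

open Complex Set Topology ComplexConjugate in
/-- Cauchy's formula for the lower half-plane, for functions decaying like `(1 + u z) / (1 + ‖z‖)`
with `u` bounded in `L¹` on horizontal lines. -/
theorem integral_div_sub_of_norm_le {F : ℂ → ℂ} {u : ℂ → ℝ} {C M : ℝ} (hC : 0 ≤ C)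
    (hc : ContinuousOn F {z : ℂ | z.im ≤ 0}) (hd : DifferentiableOn ℂ F {z : ℂ | z.im < 0})
    (hu : ∀ z, 0 ≤ u z)
    (huI : ∀ y : ℝ, y ≤ 0 → Integrable fun x : ℝ => u (x + y * I))
    (huM : ∀ y : ℝ, y ≤ 0 → ∫ x : ℝ, u (x + y * I) ≤ M)
    (hF : ∀ v : ℂ, v.im ≤ 0 → ‖F v‖ ≤ C * ((1 + u v) / (1 + ‖v‖))) {z : ℂ} (hz : z.im < 0) :
    ∫ t : ℝ, F t / (t - z) = -(2 * Real.pi * I) * F z := by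
  have hopen : IsOpen {z : ℂ | z.im < 0} := isOpen_lt continuous_im continuous_const
  have hclosed : IsClosed {z : ℂ | z.im ≤ 0} := isClosed_le continuous_im continuous_const
  have hw : 0 < (conj z).im := by simpa using hz
  set D : ℝ := ‖z - conj z‖ * ((1 + ‖conj z‖) / (conj z).im + 1) with hD
  have hD0 : 0 ≤ D := by positivity
  have hne {v : ℂ} (hv : v.im ≤ 0) : v - conj z ≠ 0 := by
    rw [← norm_pos_iff]
    exact hw.trans_le (im_le_norm_sub hv)
  have hψ (v : ℂ) (hv : v.im ≤ 0) : ‖(z - conj z) / (v - conj z)‖ ≤ D * (1 / (1 + ‖v‖)) := by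
    rw [norm_div, div_eq_mul_inv, hD, mul_assoc, mul_one_div]
    gcongr
    exact inv_norm_sub_le hw (im_le_norm_sub hv)
  set F₁ : ℂ → ℂ := fun v => F v - F z * ((z - conj z) / (v - conj z)) with hF₁
  have hc₁ : ContinuousOn F₁ {z : ℂ | z.im ≤ 0} :=
    hc.sub (continuousOn_const.mul (continuousOn_const.div (by fun_prop) fun v hv => hne hv))
  have hd₁ : DifferentiableOn ℂ F₁ {z : ℂ | z.im < 0} :=
    hd.sub ((differentiableOn_const _).mul ((differentiableOn_const _).div (by fun_prop)
      fun v hv => hne (le_of_lt hv)))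
  have hF₁z : F₁ z = 0 := by simp [hF₁, div_self (hne hz.le)]
  have hslope {v : ℂ} (hv : v ≠ z) : dslope F₁ z v = F₁ v / (v - z) := by
    rw [dslope_of_ne _ hv, slope_def_field, hF₁z, sub_zero]
  have hcG : ContinuousOn (dslope F₁ z) {z : ℂ | z.im ≤ 0} :=
    (continuousOn_dslope (mem_of_superset (hopen.mem_nhds hz) fun v (hv : v.im < 0) => hv.le)).2
      ⟨hc₁, hd₁.differentiableAt (hopen.mem_nhds hz)⟩
  have hdG : DifferentiableOn ℂ (dslope F₁ z) {z : ℂ | z.im < 0} :=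
    (differentiableOn_dslope (hopen.mem_nhds hz)).2 hd₁
  obtain ⟨K, hK⟩ := ((isCompact_closedBall z 1).inter_right hclosed).exists_bound_of_continuousOn
    (hcG.mono inter_subset_right)
  have hK0 : 0 ≤ K := (norm_nonneg _).trans (hK z ⟨by simp, hz.le⟩)
  set A : ℝ := (C + ‖F z‖ * D) * (2 + ‖z‖) with hA
  have hA0 : 0 ≤ A := by positivity
  have hG (v : ℂ) (hv : v.im ≤ 0) :
      ‖dslope F₁ z v‖ ≤ (A + K * (2 + ‖z‖) ^ 2) * ((1 + u v) / (1 + ‖v‖) ^ 2) := by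
    have huv := hu v
    rcases le_total ‖v - z‖ 1 with h | h
    · have h1 : ‖v‖ ≤ ‖z‖ + 1 := by
        have := norm_add_le z (v - z)
        rw [add_sub_cancel] at this
        linarith
      calc ‖dslope F₁ z v‖ ≤ K := hK v ⟨by simpa [dist_eq_norm] using h, hv⟩
        _ = K * (1 + ‖v‖) ^ 2 * (1 / (1 + ‖v‖) ^ 2) := by field_simp
        _ ≤ (A + K * (2 + ‖z‖) ^ 2) * ((1 + u v) / (1 + ‖v‖) ^ 2) := by
          gcongr
          · have : K * (1 + ‖v‖) ^ 2 ≤ K * (2 + ‖z‖) ^ 2 := by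
              gcongr K * ?_ ^ 2
              linarith
            linarith
          · linarith
    · have hvz : v ≠ z := by rintro rfl; norm_num at h
      have h2 := inv_norm_sub_le one_pos h
      have h3 : ‖F₁ v‖ ≤ (C + ‖F z‖ * D) * ((1 + u v) / (1 + ‖v‖)) := by
        refine (norm_sub_le _ _).trans ?_
        rw [norm_mul, add_mul, mul_assoc]
        gcongr
        · exact hF v hv
        · refine (hψ v hv).trans ?_
          gcongr
          linarith
      rw [hslope hvz, norm_div, div_eq_mul_inv]
      calc ‖F₁ v‖ * ‖v - z‖⁻¹
          ≤ (C + ‖F z‖ * D) * ((1 + u v) / (1 + ‖v‖)) * (((1 + ‖z‖) / 1 + 1) / (1 + ‖v‖)) := by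
            gcongr
        _ = A * ((1 + u v) / (1 + ‖v‖) ^ 2) := by rw [hA]; field_simp; ring
        _ ≤ _ := by gcongr; linarith [show 0 ≤ K * (2 + ‖z‖) ^ 2 by positivity]
  obtain ⟨hGi, hG0⟩ := integral_real_eq_zero_of_norm_le (by positivity) hcG hdG hu huI huM hG
  obtain ⟨hPi, hP⟩ := integral_poisson_kernel hz
  have hreal (t : ℝ) : F t / (t - z) =
      dslope F₁ z t + F z * ((z - conj z) / (t - conj z) / (t - z)) := by
    rw [hslope (fun h => by simp [← h] at hz)]
    simp only [hF₁]
    ring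
  simp_rw [hreal]
  rw [integral_add hGi (hPi.const_mul _), hG0, integral_const_mul, hP]
  ring

open Complex Topology in
/-- The sections `x ↦ f (x + iy)` of a Hardy class function stay uniformly bounded in `L^p` up to
and including `y = 0`. -/
theorem HardyBelow.exists_integral_norm_rpow_le {p : ℝ} (hp : 1 ≤ p) {f : ℂ → ℂ}
    (hf : HardyBelow p f) : ∃ M : ℝ, ∀ y : ℝ, y ≤ 0 →
      Integrable (fun x : ℝ => ‖f (x + y * I)‖ ^ p) ∧ ∫ x : ℝ, ‖f (x + y * I)‖ ^ p ≤ M := by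
  obtain ⟨-, hc, M, hM⟩ := hf
  refine ⟨M, fun y hy => ?_⟩
  rcases hy.lt_or_eq with hy | rfl
  · exact hM y hy
  have hp0 : 0 ≤ p := by linarith
  have hcy (y : ℝ) (hy : y ≤ 0) : Continuous fun x : ℝ => ‖f (x + y * I)‖ ^ p :=
    (hc.comp_continuous (by fun_prop) (by simpa using hy)).norm.rpow_const fun _ => Or.inr hp0
  set a : ℕ → ℝ := fun n => -(1 / ((n : ℝ) + 1)) with ha
  have ha0 (n : ℕ) : a n < 0 := neg_lt_zero.2 (by positivity)
  have halim : Tendsto a atTop (𝓝 0) := by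
    simpa [ha] using (tendsto_one_div_add_atTop_nhds_zero_nat (𝕜 := ℝ)).neg
  have hpt (x : ℝ) : Tendsto (fun n => ‖f (x + a n * I)‖ ^ p) atTop
      (𝓝 (‖f (x + (0 : ℝ) * I)‖ ^ p)) := by
    have hcy' : ContinuousOn (fun y : ℝ => ‖f (x + y * I)‖ ^ p) (Set.Iic 0) :=
      (hc.comp (by fun_prop) fun y (hy : y ≤ 0) => by simpa using hy).norm.rpow_const
        fun _ _ => Or.inr hp0
    exact (hcy' 0 Set.self_mem_Iic).tendsto.comp
      (tendsto_nhdsWithin_iff.2 ⟨halim, Eventually.of_forall fun n => (ha0 n).le⟩)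
  have hle : ∫⁻ x : ℝ, ‖‖f (x + (0 : ℝ) * I)‖ ^ p‖ₑ ≤ ENNReal.ofReal M := by
    refine (lintegral_enorm_le_liminf_of_tendsto (ae_of_all _ hpt)
      fun n => (hcy _ (ha0 n).le).enorm.measurable.aemeasurable).trans ?_
    refine liminf_le_of_frequently_le' (Frequently.of_forall fun n => ?_)
    rw [← ofReal_integral_norm_eq_lintegral_enorm (hM _ (ha0 n)).1]
    refine ENNReal.ofReal_le_ofReal (le_trans (le_of_eq ?_) (hM _ (ha0 n)).2)
    exact integral_congr_ae (ae_of_all _ fun x => Real.norm_of_nonneg (by positivity))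
  have hint : Integrable fun x : ℝ => ‖f (x + (0 : ℝ) * I)‖ ^ p :=
    ⟨(hcy 0 le_rfl).aestronglyMeasurable, hle.trans_lt ENNReal.ofReal_lt_top⟩
  refine ⟨hint, ?_⟩
  have hM0 : 0 ≤ M := le_trans (integral_nonneg fun x => by positivity) (hM _ (ha0 0)).2
  rw [← ofReal_integral_norm_eq_lintegral_enorm hint, ENNReal.ofReal_le_ofReal_iff hM0] at hle
  refine le_trans (le_of_eq ?_) hle
  exact integral_congr_ae (ae_of_all _ fun x => (Real.norm_of_nonneg (by positivity)).symm)

open Complex in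
theorem integrable_div_sub_of_norm_rpow {p : ℝ} (hp : 1 ≤ p) {g : ℝ → ℂ} (hg : Continuous g)
    (hgp : Integrable fun t => ‖g t‖ ^ p) {z : ℂ} (hz : z.im < 0) :
    Integrable fun t : ℝ => g t / (t - z) := by
  have hne (t : ℝ) : (t : ℂ) - z ≠ 0 := fun h => by
    simpa using hz.ne (by simpa using congrArg im h)
  have hcont : Continuous fun t : ℝ => g t / (t - z) := hg.div (by fun_prop) hne
  have hr : 0 < -z.im := by linarith
  set D : ℝ := (1 + ‖z‖) / (-z.im) + 1 with hD
  have hD0 : 0 ≤ D := by positivity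
  have hinv (t : ℝ) : ‖(t : ℂ) - z‖⁻¹ ≤ D * (1 + ‖t‖)⁻¹ := by
    have h := inv_norm_sub_le (v := (t : ℂ)) (w := z) hr
      (by simpa using (le_abs_self _).trans (abs_im_le_norm ((t : ℂ) - z)))
    rwa [norm_real, div_eq_mul_inv] at h
  rcases hp.eq_or_lt with rfl | hp
  · refine (hgp.const_mul D).mono' hcont.aestronglyMeasurable (ae_of_all _ fun t => ?_)
    rw [norm_div, div_eq_mul_inv, mul_comm, Real.rpow_one]
    gcongr
    refine (hinv t).trans (mul_le_of_le_one_right hD0 (inv_le_one_of_one_le₀ ?_))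
    linarith [norm_nonneg t]
  · have hpq := Real.HolderConjugate.conjExponent hp
    set q := p.conjExponent
    have hq : Integrable fun t : ℝ => (1 + ‖t‖) ^ (-q) :=
      integrable_one_add_norm (by simpa using hpq.symm.lt)
    refine ((hgp.div_const p).add ((hq.const_mul (D ^ q)).div_const q)).mono'
      hcont.aestronglyMeasurable (ae_of_all _ fun t => ?_)
    have hq0 := hpq.symm.pos
    rw [norm_div, div_eq_mul_inv]
    refine (Real.young_inequality_of_nonneg (norm_nonneg _) (by positivity) hpq).trans ?_
    simp only [Pi.add_apply]
    gcongr
    rw [Real.rpow_neg (by positivity), ← Real.inv_rpow (by positivity),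
      ← Real.mul_rpow hD0 (by positivity)]
    exact Real.rpow_le_rpow (by positivity) (hinv t) hq0.le

/-- Titchmarsh theorem, representation part, lower half-plane. -/
theorem titchmarsh_repr_below (p : ℝ) (hp : 1 ≤ p) (f : ℂ → ℂ)
    (hf : HardyBelow p f) (z : ℂ) (hz : z.im < 0) :
    f z = -(1 / (2 * Real.pi * Complex.I)) * ∫ t : ℝ, f t / (↑t - z) := by
  open Complex Topology in
  obtain ⟨M, hM⟩ := hf.exists_integral_norm_rpow_le hp
  obtain ⟨hd, hc, -⟩ := hf
  have hint : Integrable fun t : ℝ => f t / (t - z) :=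
    integrable_div_sub_of_norm_rpow hp
      (hc.comp_continuous continuous_ofReal (by simp)) (by simpa using (hM 0 le_rfl).1) hz
  set w : ℕ → ℂ := fun n => ((n + 1 : ℝ) : ℂ) * I with hw
  have hwim (n : ℕ) : (w n).im = n + 1 := by simp [hw]
  have hwnorm (n : ℕ) : ‖w n‖ = n + 1 := by
    rw [hw, norm_mul, norm_I, mul_one, norm_real, Real.norm_of_nonneg (by positivity)]
  have hsub (n : ℕ) {v : ℂ} (hv : v.im ≤ 0) : (n + 1 : ℝ) ≤ ‖v - w n‖ :=
    hwim n ▸ im_le_norm_sub hv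
  have hpos (n : ℕ) : (0 : ℝ) < n + 1 := by positivity
  have hne (n : ℕ) {v : ℂ} (hv : v.im ≤ 0) : v - w n ≠ 0 :=
    norm_pos_iff.1 ((hpos n).trans_le (hsub n hv))
  set φ : ℕ → ℂ → ℂ := fun n v => -w n / (v - w n) with hφ
  have hφ1 (n : ℕ) {v : ℂ} (hv : v.im ≤ 0) : ‖φ n v‖ ≤ 1 := by
    rw [hφ, norm_div, norm_neg, hwnorm]
    exact div_le_one_of_le₀ (hsub n hv) (norm_nonneg _)
  have hφlim (v : ℂ) (hv : v.im ≤ 0) : Tendsto (fun n => φ n v) atTop (𝓝 1) := by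
    have h1 : Tendsto (fun n => v / (v - w n)) atTop (𝓝 0) := by
      have h2 : Tendsto (fun n : ℕ => ‖v‖ / ((n : ℝ) + 1)) atTop (𝓝 0) := by
        simpa [div_eq_mul_inv] using
          (tendsto_one_div_add_atTop_nhds_zero_nat (𝕜 := ℝ)).const_mul ‖v‖
      refine squeeze_zero_norm (fun n => ?_) h2
      rw [norm_div]
      exact div_le_div_of_nonneg_left (norm_nonneg _) (hpos n) (hsub n hv)
    have h3 : Tendsto (fun n => 1 - v / (v - w n)) atTop (𝓝 1) := by
      simpa using h1.const_sub 1
    refine h3.congr fun n => ?_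
    have := hne n hv
    simp only [hφ]
    field_simp
    ring
  have hcauchy (n : ℕ) : ∫ t : ℝ, f t * φ n t / (t - z) = -(2 * Real.pi * I) * (f z * φ n z) := by
    set D : ℝ := ‖w n‖ * ((1 + ‖w n‖) / (n + 1) + 1) with hD
    refine integral_div_sub_of_norm_le (F := fun v => f v * φ n v) (u := fun v => ‖f v‖ ^ p)
      (C := D) (M := M) (by positivity)
      (hc.mul (continuousOn_const.div (by fun_prop) fun v hv => hne n hv))
      (hd.mul ((differentiableOn_const _).div (by fun_prop) fun v hv => hne n (le_of_lt hv)))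
      (fun v => by positivity) (fun y hy => (hM y hy).1) (fun y hy => (hM y hy).2)
      (fun v hv => ?_) hz
    have h1 : ‖f v‖ ≤ 1 + ‖f v‖ ^ p := by
      rcases le_total ‖f v‖ 1 with h | h
      · linarith [Real.rpow_nonneg (norm_nonneg (f v)) p]
      · linarith [Real.self_le_rpow_of_one_le h hp]
    have h2 := inv_norm_sub_le (hpos n) (hsub n hv)
    rw [norm_mul, hφ, norm_div, norm_neg, div_eq_mul_inv]
    calc ‖f v‖ * (‖w n‖ * ‖v - w n‖⁻¹)
        ≤ (1 + ‖f v‖ ^ p) * (‖w n‖ * (((1 + ‖w n‖) / (n + 1) + 1) / (1 + ‖v‖))) := by gcongr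
      _ = D * ((1 + ‖f v‖ ^ p) / (1 + ‖v‖)) := by rw [hD]; ring
  have hlim : Tendsto (fun n => ∫ t : ℝ, f t * φ n t / (t - z)) atTop
      (𝓝 (∫ t : ℝ, f t / (t - z))) := by
    have heq (n : ℕ) (t : ℝ) : f t * φ n t / (t - z) = f t / (t - z) * φ n t := by ring
    simp_rw [heq]
    refine tendsto_integral_of_dominated_convergence (fun t : ℝ => ‖f t / (t - z)‖)
      (fun n => hint.aestronglyMeasurable.mul ?_) hint.norm
      (fun n => ae_of_all _ fun t => ?_) (ae_of_all _ fun t => ?_)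
    · exact (continuous_const.div (by fun_prop)
        fun t : ℝ => hne n (by simp)).aestronglyMeasurable
    · rw [norm_mul]
      exact mul_le_of_le_one_right (norm_nonneg _) (hφ1 n (by simp))
    · simpa using (hφlim t (by simp)).const_mul (f t / (t - z))
  have hlim' : Tendsto (fun n => ∫ t : ℝ, f t * φ n t / (t - z)) atTop
      (𝓝 (-(2 * Real.pi * I) * f z)) := by
    simp_rw [hcauchy]
    simpa using ((hφlim z hz.le).const_mul (f z)).const_mul (-(2 * Real.pi * I))
  rw [tendsto_nhds_unique hlim hlim']
  have hpi : (2 * Real.pi * I : ℂ) ≠ 0 := two_pi_I_ne_zero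
  field_simp
end

section
/- Let 1 ≤ p < ∞ and let f be Hardy class from below of order p. Then for every z ∈ ℂ with Im z > 0 one has ∫_ℝ f(t)/(t − z) dt = 0, where the integral is over the boundary values of f on the real axis. (Titchmarsh theorem, vanishing part, lower half-plane.) -/
open MeasureTheory Filter

/-- Distance from `x - iY` to a point of the upper half-plane. -/
theorem sq_add_sq_le_norm_sub_sq {z : ℂ} (hz : 0 < z.im) {Y : ℝ} (hY : 0 ≤ Y) (x : ℝ) :
    Y ^ 2 + (x - z.re) ^ 2 ≤ ‖(x : ℂ) + ((-Y : ℝ) : ℂ) * Complex.I - z‖ ^ 2 := by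
  rw [Complex.sq_norm, Complex.normSq_apply]
  simp
  nlinarith [mul_nonneg hY hz.le]

theorem le_norm_sub {z : ℂ} (hz : 0 < z.im) {Y : ℝ} (hY : 0 ≤ Y) (x : ℝ) :
    Y ≤ ‖(x : ℂ) + ((-Y : ℝ) : ℂ) * Complex.I - z‖ :=
  (abs_le_of_sq_le_sq' (by nlinarith [sq_add_sq_le_norm_sub_sq hz hY x, sq_nonneg (x - z.re)])
    (norm_nonneg _)).2

theorem inv_norm_rpow_le {z : ℂ} (hz : 0 < z.im) {q Y : ℝ} (hq : 0 ≤ q) (hY : 1 ≤ Y) (x : ℝ) :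
    ‖(x : ℂ) + ((-Y : ℝ) : ℂ) * Complex.I - z‖⁻¹ ^ q ≤ (1 + ‖x - z.re‖ ^ 2) ^ (-q / 2) := by
  have hpos : (0 : ℝ) < 1 + ‖x - z.re‖ ^ 2 := by positivity
  have h2 : 1 + ‖x - z.re‖ ^ 2 ≤ ‖(x : ℂ) + ((-Y : ℝ) : ℂ) * Complex.I - z‖ ^ 2 := by
    have := sq_add_sq_le_norm_sub_sq hz (by linarith : 0 ≤ Y) x
    rw [Real.norm_eq_abs, sq_abs]
    nlinarith
  set a := ‖(x : ℂ) + ((-Y : ℝ) : ℂ) * Complex.I - z‖ with ha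
  have ha0 : 0 ≤ a := norm_nonneg _
  have : a⁻¹ ^ q = (a ^ 2) ^ (-q / 2) := by
    rw [← Real.rpow_natCast, ← Real.rpow_mul ha0, Real.inv_rpow ha0, ← Real.rpow_neg ha0]
    congr 1
    push_cast
    ring
  rw [this]
  exact Real.rpow_le_rpow_of_nonpos hpos h2 (by linarith)

theorem integrable_one_add_sub_sq_rpow {q : ℝ} (hq : 1 < q) (a : ℝ) :
    Integrable (fun x : ℝ => (1 + ‖x - a‖ ^ 2) ^ (-q / 2)) :=
  (integrable_rpow_neg_one_add_norm_sq (E := ℝ) (μ := volume) (r := q)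
    (by simpa using hq)).comp_sub_right a

theorem aestronglyMeasurable_inv_norm_rpow (z : ℂ) (q Y : ℝ) :
    AEStronglyMeasurable
      (fun x : ℝ => ‖(x : ℂ) + ((-Y : ℝ) : ℂ) * Complex.I - z‖⁻¹ ^ q) := by
  apply Measurable.aestronglyMeasurable
  fun_prop

theorem integrable_inv_norm_rpow {z : ℂ} (hz : 0 < z.im) {q Y : ℝ} (hq : 1 < q) (hY : 1 ≤ Y) :
    Integrable (fun x : ℝ => ‖(x : ℂ) + ((-Y : ℝ) : ℂ) * Complex.I - z‖⁻¹ ^ q) := by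
  refine (integrable_one_add_sub_sq_rpow hq z.re).mono'
    (aestronglyMeasurable_inv_norm_rpow z q Y) (Eventually.of_forall fun x => ?_)
  rw [Real.norm_of_nonneg (by positivity)]
  exact inv_norm_rpow_le hz (by linarith) hY x

theorem tendsto_integral_inv_norm_rpow {z : ℂ} (hz : 0 < z.im) {q : ℝ} (hq : 1 < q) :
    Tendsto (fun Y : ℝ => ∫ x : ℝ, ‖(x : ℂ) + ((-Y : ℝ) : ℂ) * Complex.I - z‖⁻¹ ^ q)
      atTop (nhds 0) := by
  have h := tendsto_integral_filter_of_dominated_convergence (μ := volume) (l := atTop)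
    (F := fun (Y x : ℝ) => ‖(x : ℂ) + ((-Y : ℝ) : ℂ) * Complex.I - z‖⁻¹ ^ q)
    (f := fun _ => 0) (fun x : ℝ => (1 + ‖x - z.re‖ ^ 2) ^ (-q / 2))
    (Eventually.of_forall fun Y => aestronglyMeasurable_inv_norm_rpow z q Y) ?_
    (integrable_one_add_sub_sq_rpow hq z.re) ?_
  · simpa using h
  · filter_upwards [eventually_ge_atTop 1] with Y hY
    refine Eventually.of_forall fun x => ?_
    rw [Real.norm_of_nonneg (by positivity)]
    exact inv_norm_rpow_le hz (by linarith) hY x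
  · refine Eventually.of_forall fun x => ?_
    have h0 : Tendsto (fun Y : ℝ => ‖(x : ℂ) + ((-Y : ℝ) : ℂ) * Complex.I - z‖) atTop atTop :=
      tendsto_atTop_mono' _ ((eventually_ge_atTop 0).mono fun Y hY => le_norm_sub hz hY x)
        tendsto_id
    have h1 := h0.inv_tendsto_atTop.rpow_const (p := q) (Or.inr (by linarith))
    rwa [Real.zero_rpow (by linarith)] at h1

/-- On low horizontal lines, `f / (· - z)` is dominated by an integrable function of small
integral. -/
theorem HardyBelow.exists_dominating {p : ℝ} (hp : 1 ≤ p) {f : ℂ → ℂ} (hf : HardyBelow p f)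
    {z : ℂ} (hz : 0 < z.im) {ε : ℝ} (hε : 0 < ε) :
    ∃ Y : ℝ, 0 < Y ∧ ∃ g : ℝ → ℝ, Integrable g ∧ ∫ x, g x ≤ ε ∧
      ∀ x : ℝ, ‖f (x + ((-Y : ℝ) : ℂ) * Complex.I) / (x + ((-Y : ℝ) : ℂ) * Complex.I - z)‖
        ≤ g x := by
  obtain ⟨-, -, M, hM⟩ := hf
  have hM0 : 0 ≤ M := le_trans (integral_nonneg fun x => by positivity) (hM (-1) (by norm_num)).2
  rcases hp.eq_or_lt with rfl | hp
  · refine ⟨M / ε + 1, by positivity,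
      fun x => (M / ε + 1)⁻¹ * ‖f (x + ((-(M / ε + 1) : ℝ) : ℂ) * Complex.I)‖ ^ (1 : ℝ), ?_, ?_, ?_⟩
    · exact (hM _ (neg_lt_zero.2 (by positivity))).1.const_mul _
    · rw [integral_const_mul]
      refine (mul_le_mul_of_nonneg_left (hM _ (neg_lt_zero.2 (by positivity))).2
        (by positivity)).trans ?_
      rw [inv_mul_le_iff₀ (by positivity)]
      have : M / ε * ε = M := by field_simp
      nlinarith
    · intro x
      simp only [Real.rpow_one]
      rw [norm_div, div_eq_inv_mul]
      gcongr
      exact le_norm_sub hz (by positivity) x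
  · have hpq := Real.HolderConjugate.conjExponent hp
    set q := p.conjExponent
    have hq : 1 < q := hpq.symm.lt
    obtain ⟨lam, hlam, hlamM⟩ : ∃ lam : ℝ, 0 < lam ∧ lam ^ p * M ≤ ε / 2 := by
      refine ⟨(ε / 2 / (M + 1)) ^ p⁻¹, by positivity, ?_⟩
      rw [Real.rpow_inv_rpow (by positivity) (by linarith), div_mul_eq_mul_div,
        div_le_iff₀ (by positivity)]
      nlinarith
    have ht := (tendsto_integral_inv_norm_rpow hz hq).const_mul (lam⁻¹ ^ q)
    rw [mul_zero] at ht
    obtain ⟨Y, hYε, hY⟩ := ((ht.eventually_le_const (half_pos hε)).and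
      (eventually_ge_atTop 1)).exists
    have hY0 : 0 < Y := by linarith
    have hfY := hM (-Y) (by linarith)
    refine ⟨Y, hY0, fun x => lam ^ p * ‖f (x + ((-Y : ℝ) : ℂ) * Complex.I)‖ ^ p +
      lam⁻¹ ^ q * ‖(x : ℂ) + ((-Y : ℝ) : ℂ) * Complex.I - z‖⁻¹ ^ q,
      (hfY.1.const_mul _).add ((integrable_inv_norm_rpow hz hq hY).const_mul _), ?_, fun x => ?_⟩
    · rw [integral_add (hfY.1.const_mul _) ((integrable_inv_norm_rpow hz hq hY).const_mul _),
        integral_const_mul, integral_const_mul]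
      have := mul_le_mul_of_nonneg_left hfY.2 (by positivity : 0 ≤ lam ^ p)
      linarith
    · set a := ‖f (x + ((-Y : ℝ) : ℂ) * Complex.I)‖ with ha
      set b := ‖(x : ℂ) + ((-Y : ℝ) : ℂ) * Complex.I - z‖⁻¹ with hb
      have ha0 : 0 ≤ a := norm_nonneg _
      have hb0 : 0 ≤ b := inv_nonneg.2 (norm_nonneg _)
      have h := Real.young_inequality_of_nonneg (by positivity : 0 ≤ lam * a)
        (by positivity : 0 ≤ lam⁻¹ * b) hpq
      have h1 : lam * a * (lam⁻¹ * b) = a * b := by field_simp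
      have h2 : (lam * a) ^ p / p ≤ (lam * a) ^ p := div_le_self (by positivity) hp.le
      have h3 : (lam⁻¹ * b) ^ q / q ≤ (lam⁻¹ * b) ^ q := div_le_self (by positivity) hq.le
      rw [Real.mul_rpow hlam.le ha0] at h2
      rw [Real.mul_rpow (by positivity) hb0] at h3
      rw [Real.mul_rpow hlam.le ha0, Real.mul_rpow (by positivity) hb0] at h
      rw [norm_div, div_eq_mul_inv]
      linarith

theorem HardyBelow.integrable_prod {p : ℝ} (hp : 0 ≤ p) {f : ℂ → ℂ} (hf : HardyBelow p f)
    (Y : ℝ) :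
    Integrable (fun w : ℝ × ℝ => ‖f (w.1 + w.2 * Complex.I)‖ ^ p)
      (volume.prod (volume.restrict (Set.Ioo (-Y) 0))) := by
  obtain ⟨-, hc, M, hM⟩ := hf
  have hmeas : AEStronglyMeasurable (fun w : ℝ × ℝ => ‖f (w.1 + w.2 * Complex.I)‖ ^ p)
      (volume.prod (volume.restrict (Set.Ioo (-Y) 0))) := by
    rw [← Measure.restrict_univ (μ := (volume : Measure ℝ)), Measure.restrict_restrict_of_subset
      (Set.subset_univ _), Measure.prod_restrict]
    refine ContinuousOn.aestronglyMeasurable ?_ (MeasurableSet.univ.prod measurableSet_Ioo)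
    refine ContinuousOn.rpow_const (ContinuousOn.norm (hc.comp (by fun_prop) ?_))
      fun _ _ => Or.inr hp
    rintro ⟨x, y⟩ ⟨-, hy⟩
    simpa using hy.2.le
  refine (integrable_prod_iff' hmeas).2 ⟨?_, ?_⟩
  · filter_upwards [ae_restrict_mem measurableSet_Ioo] with y hy using (hM y hy.2).1
  · refine Integrable.mono' (integrable_const M) hmeas.norm.prod_swap.integral_prod_right' ?_
    filter_upwards [ae_restrict_mem measurableSet_Ioo] with y hy
    rw [Real.norm_of_nonneg (integral_nonneg fun _ => norm_nonneg _)]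
    refine le_of_eq_of_le (integral_congr_ae (Eventually.of_forall fun x => ?_)) (hM y hy.2).2
    exact Real.norm_of_nonneg (by positivity)

theorem frequently_le_one_of_integrable {h : ℝ → ℝ} (hi : Integrable h) :
    ∃ᶠ x in atTop, h x ≤ 1 := by
  intro hev
  obtain ⟨a, ha⟩ := eventually_atTop.1 hev
  have hlt := hi.measure_ge_lt_top (ε := 1) one_pos
  have hsub : Set.Ici a ⊆ {x | 1 ≤ h x} := fun x hx => (not_le.1 (ha x hx)).le
  exact absurd (measure_mono hsub) (by rw [Real.volume_Ici]; exact not_le.2 hlt)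

theorem HardyBelow.frequently_vertical_le {p : ℝ} (hp : 0 ≤ p) {f : ℂ → ℂ}
    (hf : HardyBelow p f) {Y : ℝ} (hY : 0 < Y) :
    ∃ᶠ R : ℝ in atTop, (∫ y in (-Y)..0, ‖f (R + y * Complex.I)‖ ^ p) ≤ 1 ∧
      (∫ y in (-Y)..0, ‖f (((-R : ℝ) : ℂ) + y * Complex.I)‖ ^ p) ≤ 1 := by
  have h := (hf.integrable_prod hp Y).integral_prod_left
  refine (frequently_le_one_of_integrable (h.add h.comp_neg)).mono fun R hR => ?_
  simp only [Pi.add_apply] at hR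
  have h0 (r : ℝ) : 0 ≤ ∫ y in Set.Ioo (-Y) 0, ‖f (r + y * Complex.I)‖ ^ p :=
    integral_nonneg fun _ => by positivity
  rw [intervalIntegral.integral_of_le (by linarith), intervalIntegral.integral_of_le (by linarith),
    integral_Ioc_eq_integral_Ioo, integral_Ioc_eq_integral_Ioo]
  exact ⟨by linarith [h0 (-R)], by linarith [h0 R]⟩

theorem norm_vertical_integral_le {p : ℝ} (hp : 1 ≤ p) {f : ℂ → ℂ}
    (hc : ContinuousOn f {z : ℂ | z.im ≤ 0}) {z : ℂ} {Y r d : ℝ} (hY : 0 < Y) (hd : 0 < d)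
    (hr : d ≤ |r - z.re|) (hI : (∫ y in (-Y)..0, ‖f (r + y * Complex.I)‖ ^ p) ≤ 1) :
    ‖∫ y in (-Y)..0, f (r + y * Complex.I) / (r + y * Complex.I - z)‖ ≤ (Y + 1) / d := by
  have hi : IntervalIntegrable (fun y : ℝ => ‖f (r + y * Complex.I)‖ ^ p) volume (-Y) 0 := by
    refine ContinuousOn.intervalIntegrable (ContinuousOn.rpow_const
      (ContinuousOn.norm (hc.comp (by fun_prop) ?_)) fun _ _ => Or.inr (by linarith))
    intro y hy
    rw [Set.uIcc_of_le (by linarith)] at hy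
    simpa using hy.2
  have h1 : IntervalIntegrable (fun _ : ℝ => (1 : ℝ)) volume (-Y) 0 := intervalIntegrable_const
  refine (intervalIntegral.norm_integral_le_of_norm_le (by linarith)
    (g := fun y => (1 + ‖f (r + y * Complex.I)‖ ^ p) / d)
    (Eventually.of_forall fun y _ => ?_) ((h1.add hi).div_const d)).trans ?_
  · rw [norm_div]
    gcongr
    · rcases le_total ‖f (r + y * Complex.I)‖ 1 with h | h
      · have : 0 ≤ ‖f (r + y * Complex.I)‖ ^ p := by positivity
        linarith
      · linarith [Real.self_le_rpow_of_one_le h hp]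
    · refine hr.trans ?_
      simpa using Complex.abs_re_le_norm ((r : ℂ) + y * Complex.I - z)
  · rw [intervalIntegral.integral_div, intervalIntegral.integral_add h1 hi]
    simp only [intervalIntegral.integral_const, smul_eq_mul]
    gcongr
    linarith

/-- Cauchy's theorem for `f / (· - z)` on the rectangle `[-R, R] × [-Y, 0]`. -/
theorem integral_rect_eq {f : ℂ → ℂ} (hd : DifferentiableOn ℂ f {z : ℂ | z.im < 0})
    (hc : ContinuousOn f {z : ℂ | z.im ≤ 0}) {z : ℂ} (hz : 0 < z.im) {Y : ℝ} (hY : 0 < Y)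
    (R : ℝ) :
    ∫ t in (-R)..R, f t / (t - z) =
      (∫ x in (-R)..R, f (x + ((-Y : ℝ) : ℂ) * Complex.I) /
        (x + ((-Y : ℝ) : ℂ) * Complex.I - z)) +
      Complex.I * (∫ y in (-Y)..0, f (R + y * Complex.I) / (R + y * Complex.I - z)) -
      Complex.I * ∫ y in (-Y)..0, f (((-R : ℝ) : ℂ) + y * Complex.I) /
        (((-R : ℝ) : ℂ) + y * Complex.I - z) := by
  have hne : ∀ w : ℂ, w.im ≤ 0 → w - z ≠ 0 := fun w hw h => by
    rw [sub_eq_zero.1 h] at hw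
    linarith
  have h := Complex.integral_boundary_rect_eq_zero_of_continuousOn_of_differentiableOn
    (fun w => f w / (w - z)) ⟨-R, -Y⟩ ⟨R, 0⟩ ?_ ?_
  · simp only [Complex.ofReal_zero, zero_mul, add_zero, smul_eq_mul] at h
    linear_combination -h
  · have hsub : Set.uIcc (-R) R ×ℂ Set.uIcc (-Y) 0 ⊆ {w : ℂ | w.im ≤ 0} := by
      rintro w ⟨-, hw⟩
      rw [Set.mem_preimage, Set.uIcc_of_le (by linarith)] at hw
      exact hw.2
    exact (hc.mono hsub).div (by fun_prop) fun w hw => hne w (hsub hw)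
  · have hsub : Set.Ioo (min (-R) R) (max (-R) R) ×ℂ Set.Ioo (min (-Y) 0) (max (-Y) 0) ⊆
        {w : ℂ | w.im < 0} := by
      rintro w ⟨-, hw⟩
      rw [Set.mem_preimage, max_eq_right (by linarith : -Y ≤ 0)] at hw
      exact hw.2
    exact (hd.mono hsub).div (by fun_prop) fun w hw => hne w (hsub hw).le

/-- Titchmarsh theorem, vanishing part, lower half-plane. -/
theorem titchmarsh_vanish_below (p : ℝ) (hp : 1 ≤ p) (f : ℂ → ℂ)
    (hf : HardyBelow p f) (z : ℂ) (hz : 0 < z.im) :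
    ∫ t : ℝ, f t / (↑t - z) = 0 := by
  by_cases hint : Integrable fun t : ℝ => f t / (↑t - z)
  swap
  · exact integral_undef hint
  refine norm_le_zero_iff.1 (le_of_forall_pos_le_add fun ε hε => ?_)
  obtain ⟨Y, hY, g, hg, hgε, hfg⟩ := hf.exists_dominating hp hz (half_pos hε)
  have hd : Tendsto (fun R : ℝ => R - |z.re|) atTop atTop :=
    tendsto_atTop_add_const_right _ _ tendsto_id
  have hfreq := (hf.frequently_vertical_le (by linarith) hY).and_eventually
    ((hd.eventually_ge_atTop ((Y + 1) / (ε / 4))).and (eventually_ge_atTop 0))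
  have hlim := (intervalIntegral_tendsto_integral hint tendsto_neg_atTop_atBot tendsto_id).norm
  rw [zero_add]
  refine isClosed_Iic.mem_of_frequently_of_tendsto (s := Set.Iic ε) (hfreq.mono ?_) hlim
  rintro R ⟨⟨hR1, hR2⟩, hRd, hR0⟩
  have hdpos : 0 < R - |z.re| := lt_of_lt_of_le (by positivity) hRd
  have hside : (Y + 1) / (R - |z.re|) ≤ ε / 4 := by
    rw [div_le_iff₀ hdpos]
    rw [div_le_iff₀ (by positivity)] at hRd
    linarith
  have hright := norm_vertical_integral_le hp hf.2.1 (z := z) (r := R) hY hdpos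
    (by linarith [le_abs_self (R - z.re), le_abs_self z.re]) hR1
  have hleft := norm_vertical_integral_le hp hf.2.1 (z := z) (r := -R) hY hdpos
    (by linarith [neg_abs_le (-R - z.re), neg_abs_le z.re]) hR2
  have hbot : ‖∫ x in (-R)..R, f (x + ((-Y : ℝ) : ℂ) * Complex.I) /
      (x + ((-Y : ℝ) : ℂ) * Complex.I - z)‖ ≤ ε / 2 := by
    refine (intervalIntegral.norm_integral_le_of_norm_le (by linarith)
      (Eventually.of_forall fun x _ => hfg x) hg.intervalIntegrable).trans ?_
    rw [intervalIntegral.integral_of_le (by linarith)]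
    exact (setIntegral_le_integral hg
      (Eventually.of_forall fun x => (norm_nonneg _).trans (hfg x))).trans hgε
  simp only [Set.mem_Iic, id]
  rw [integral_rect_eq hf.1 hf.2.1 hz hY R]
  refine (norm_sub_le _ _).trans ((add_le_add_left (norm_add_le _ _) _).trans ?_)
  rw [norm_mul, norm_mul, Complex.norm_I, one_mul, one_mul]
  linarith
end

section
/- Let 1 ≤ p < ∞ and let f be Hardy class from above of order p. Then f(z) = (1/(2πi)) ∫_ℝ f(t)/(t − z) dt for every z with Im z > 0, and ∫_ℝ f(t)/(t − z) dt = 0 for every z with Im z < 0, the integrals being over the boundary values of f on the real axis. (Titchmarsh theorem, upper half-plane.) -/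
open MeasureTheory Filter

/-- `f : ℂ → ℂ` is Hardy class from above of order `p`: analytic on the open upper
half-plane, continuous on the closed upper half-plane, and the `L^p` norms of the
horizontal sections `x ↦ f (x + iy)`, `y > 0`, are uniformly bounded. -/
def HardyAbove (p : ℝ) (f : ℂ → ℂ) : Prop :=
  DifferentiableOn ℂ f {z : ℂ | 0 < z.im} ∧
  ContinuousOn f {z : ℂ | 0 ≤ z.im} ∧
  ∃ M : ℝ, ∀ y : ℝ, 0 < y →
    Integrable (fun x : ℝ => ‖f (↑x + ↑y * Complex.I)‖ ^ p) ∧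
    ∫ x : ℝ, ‖f (↑x + ↑y * Complex.I)‖ ^ p ≤ M

section Aux

open Topology Set

/-- A form of Young's inequality which also covers the exponent `p = 1`. -/
theorem exists_young_bound {p : ℝ} (hp : 1 ≤ p) :
    ∃ q : ℝ, 1 < q ∧ ∀ δ : ℝ, 0 < δ → ∃ C : ℝ, 0 ≤ C ∧ ∀ A r : ℝ, 0 ≤ A → 0 ≤ r →
      A * r ≤ (δ + r) * A ^ p + C * r ^ q := by
  rcases hp.eq_or_lt with rfl | hp
  · refine ⟨2, by norm_num, fun δ hδ => ⟨0, le_rfl, fun A r hA hr => ?_⟩⟩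
    rw [Real.rpow_one]
    nlinarith [mul_nonneg hδ.le hA]
  · have hpq := Real.HolderConjugate.conjExponent hp
    set q := p.conjExponent
    refine ⟨q, hpq.symm.lt, fun δ hδ => ⟨(δ ^ (1 / p))⁻¹ ^ q / q, ?_, fun A r hA hr => ?_⟩⟩
    · have := hpq.symm.pos
      positivity
    · have hd : 0 < δ ^ (1 / p) := by positivity
      have h := Real.young_inequality_of_nonneg (mul_nonneg hd.le hA)
        (mul_nonneg (inv_nonneg.2 hd.le) hr) hpq
      rw [Real.mul_rpow hd.le hA, Real.mul_rpow (inv_nonneg.2 hd.le) hr, ← Real.rpow_mul hδ.le,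
        one_div_mul_cancel hpq.ne_zero, Real.rpow_one] at h
      have hA' : 0 ≤ A ^ p := by positivity
      calc A * r = δ ^ (1 / p) * A * ((δ ^ (1 / p))⁻¹ * r) := by field_simp
        _ ≤ _ := h
        _ ≤ _ := by
          have : δ * A ^ p / p ≤ δ * A ^ p := div_le_self (by positivity) hp.le
          have h2 : 0 ≤ r * A ^ p := by positivity
          rw [mul_div_right_comm ((δ ^ (1 / p))⁻¹ ^ q)]
          linarith

theorem integrable_inv_one_add_norm_rpow (c : ℝ) (hc : 0 < c) {q : ℝ} (hq : 1 < q) :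
    Integrable (fun t : ℝ => (c * (1 + ‖t‖)⁻¹) ^ q) := by
  have h : Integrable (fun t : ℝ => (1 + ‖t‖) ^ (-q)) := integrable_one_add_norm (by simpa using hq)
  refine (h.const_mul (c ^ q)).congr (ae_of_all _ fun t => ?_)
  have : 0 < 1 + ‖t‖ := by positivity
  simp only
  rw [Real.mul_rpow hc.le (by positivity), Real.inv_rpow this.le, Real.rpow_neg this.le]

/-- Uniform tail estimate: integrands dominated by an `L^p`-bounded function times `c / (1 + |t|)`
are integrable, and their tails are small uniformly. -/
theorem exists_uniform_tail {p : ℝ} (hp : 1 ≤ p) {c : ℝ} (hc : 0 < c) (M : ℝ) {ε : ℝ}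
    (hε : 0 < ε) :
    ∃ N : ℝ, 0 < N ∧ ∀ (A : ℝ → ℝ) (u : ℝ → ℂ), (∀ t, 0 ≤ A t) → Integrable (fun t => A t ^ p) →
      ∫ t, A t ^ p ≤ M → Continuous u → (∀ t, ‖u t‖ ≤ A t * (c * (1 + ‖t‖)⁻¹)) →
      Integrable u ∧ ‖(∫ t, u t) - ∫ t in (-N)..N, u t‖ ≤ ε := by
  obtain ⟨q, hq, hY⟩ := exists_young_bound hp
  have hM : 0 < |M| + 1 := by positivity
  set δ := ε / (4 * (|M| + 1)) with hδ
  have hδ0 : 0 < δ := by positivity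
  obtain ⟨C, hC, hY⟩ := hY δ hδ0
  have hκ := (integrable_inv_one_add_norm_rpow c hc hq).const_mul C
  have hκ0 : ∀ t : ℝ, 0 ≤ c * (1 + ‖t‖)⁻¹ := fun t => by positivity
  have hlim := intervalIntegral_tendsto_integral hκ tendsto_neg_atTop_atBot tendsto_id
  obtain ⟨N, hN0, hNd, hN⟩ : ∃ N : ℝ, 0 < N ∧ c / δ ≤ N ∧
      (∫ t : ℝ, C * (c * (1 + ‖t‖)⁻¹) ^ q) - ε / 2 ≤
        ∫ t in (-N)..N, C * (c * (1 + ‖t‖)⁻¹) ^ q := by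
    have h1 := hlim.eventually (eventually_ge_nhds
      (show (∫ t : ℝ, C * (c * (1 + ‖t‖)⁻¹) ^ q) - ε / 2 < _ by linarith))
    obtain ⟨N, h⟩ := ((eventually_gt_atTop 0).and ((eventually_ge_atTop (c / δ)).and h1)).exists
    exact ⟨N, h⟩
  refine ⟨N, hN0, fun A u hA hAi hAM hu hb => ?_⟩
  have hb' : ∀ t, ‖u t‖ ≤ (δ + c * (1 + ‖t‖)⁻¹) * A t ^ p + C * (c * (1 + ‖t‖)⁻¹) ^ q :=
    fun t => (hb t).trans (hY _ _ (hA t) (hκ0 t))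
  have hAp : ∀ t, 0 ≤ A t ^ p := fun t => Real.rpow_nonneg (hA t) p
  have hui : Integrable u := by
    refine Integrable.mono' ((hAi.const_mul (δ + c)).add hκ) hu.aestronglyMeasurable
      (ae_of_all _ fun t => (hb' t).trans ?_)
    have : c * (1 + ‖t‖)⁻¹ ≤ c :=
      mul_le_of_le_one_right hc.le (inv_le_one_of_one_le₀ (by linarith [norm_nonneg t]))
    simp only [Pi.add_apply]
    gcongr
    exact hAp t
  refine ⟨hui, ?_⟩
  have hs : MeasurableSet (Ioc (-N) N) := measurableSet_Ioc
  have hle : -N ≤ N := by linarith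
  have key : ∀ {E : Type} [NormedAddCommGroup E] [NormedSpace ℝ E] (g : ℝ → E), Integrable g →
      (∫ t, g t) - ∫ t in (-N)..N, g t = ∫ t in (Ioc (-N) N)ᶜ, g t := fun g hg => by
    rw [intervalIntegral.integral_of_le hle, ← integral_add_compl hs hg, add_sub_cancel_left]
  rw [key u hui]
  calc ‖∫ t in (Ioc (-N) N)ᶜ, u t‖
      ≤ ∫ t in (Ioc (-N) N)ᶜ, (2 * δ * A t ^ p + C * (c * (1 + ‖t‖)⁻¹) ^ q) := by
        refine norm_integral_le_of_norm_le ((hAi.const_mul _).add hκ).integrableOn ?_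
        refine (ae_restrict_iff' hs.compl).2 (ae_of_all _ fun t ht => (hb' t).trans ?_)
        have htN : N ≤ ‖t‖ := by
          by_contra! h
          rw [Real.norm_eq_abs, abs_lt] at h
          exact ht ⟨h.1, h.2.le⟩
        have : c * (1 + ‖t‖)⁻¹ ≤ δ := by
          rw [← div_eq_mul_inv, div_le_iff₀ (by positivity)]
          rw [div_le_iff₀ hδ0] at hNd
          nlinarith
        gcongr
        · exact hAp t
        · linarith
    _ = 2 * δ * (∫ t in (Ioc (-N) N)ᶜ, A t ^ p) +
          ∫ t in (Ioc (-N) N)ᶜ, C * (c * (1 + ‖t‖)⁻¹) ^ q := by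
        rw [integral_add (hAi.const_mul _).integrableOn hκ.integrableOn, integral_const_mul]
    _ ≤ 2 * δ * (|M| + 1) + ε / 2 := by
        rw [← key _ hκ]
        have h1 : ∫ t in (Ioc (-N) N)ᶜ, A t ^ p ≤ |M| + 1 :=
          (setIntegral_le_integral hAi (ae_of_all _ hAp)).trans
            (by linarith [le_abs_self M])
        gcongr
        linarith
    _ = ε := by rw [hδ]; field_simp; norm_num

/-- Convergence of integrals from convergence over compact intervals, under uniform tails. -/
theorem tendsto_integral_of_uniform_tail {p : ℝ} (hp : 1 ≤ p) {c : ℝ} (hc : 0 < c) (M : ℝ)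
    {ι : Type*} {l : Filter ι} {A : ι → ℝ → ℝ} {u : ι → ℝ → ℂ} {B : ℝ → ℝ} {v : ℝ → ℂ}
    (hu : ∀ᶠ i in l, (∀ t, 0 ≤ A i t) ∧ Integrable (fun t => A i t ^ p) ∧
      ∫ t, A i t ^ p ≤ M ∧ Continuous (u i) ∧ ∀ t, ‖u i t‖ ≤ A i t * (c * (1 + ‖t‖)⁻¹))
    (hv : (∀ t, 0 ≤ B t) ∧ Integrable (fun t => B t ^ p) ∧
      ∫ t, B t ^ p ≤ M ∧ Continuous v ∧ ∀ t, ‖v t‖ ≤ B t * (c * (1 + ‖t‖)⁻¹))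
    (huv : ∀ N : ℝ, 0 < N → Tendsto (fun i => ∫ t in (-N)..N, u i t) l (𝓝 (∫ t in (-N)..N, v t))) :
    Tendsto (fun i => ∫ t, u i t) l (𝓝 (∫ t, v t)) := by
  rw [Metric.tendsto_nhds]
  intro ε hε
  obtain ⟨N, hN, h⟩ := exists_uniform_tail hp hc M (show 0 < ε / 4 by positivity)
  filter_upwards [hu, Metric.tendsto_nhds.1 (huv N hN) (ε / 4) (by positivity)] with i hi hi'
  have h1 := (h (A i) (u i) hi.1 hi.2.1 hi.2.2.1 hi.2.2.2.1 hi.2.2.2.2).2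
  have h2 := (h B v hv.1 hv.2.1 hv.2.2.1 hv.2.2.2.1 hv.2.2.2.2).2
  rw [← dist_eq_norm] at h1 h2
  rw [dist_comm] at h2
  linarith [dist_triangle4 (∫ t, u i t) (∫ t in (-N)..N, u i t) (∫ t in (-N)..N, v t) (∫ t, v t)]

open Complex

/-- The integral of `g` over the boundary of the rectangle `[-R, R] × [y, Y]`. -/
noncomputable def rectIntegral (g : ℂ → ℂ) (y Y R : ℝ) : ℂ :=
  (∫ x : ℝ in (-R)..R, g (x + y * I)) - (∫ x : ℝ in (-R)..R, g (x + Y * I)) +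
    I * (∫ s : ℝ in y..Y, g (R + s * I)) - I * (∫ s : ℝ in y..Y, g ((-R : ℝ) + s * I))

theorem rectIntegral_eq_zero {g : ℂ → ℂ} {y Y R : ℝ} (hyY : y ≤ Y)
    (hg : DifferentiableOn ℂ g {w : ℂ | y ≤ w.im ∧ w.im ≤ Y}) : rectIntegral g y Y R = 0 := by
  have h := integral_boundary_rect_eq_zero_of_differentiableOn g (⟨-R, y⟩ : ℂ) (⟨R, Y⟩ : ℂ)
    (hg.mono fun w hw => by
      have := (mem_reProdIm.1 hw).2
      rwa [uIcc_of_le hyY] at this)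
  simpa only [rectIntegral, smul_eq_mul] using h

theorem le_one_add_rpow {p A : ℝ} (hp : 1 ≤ p) (hA : 0 ≤ A) : A ≤ 1 + A ^ p := by
  rcases le_total A 1 with h | h
  · linarith [Real.rpow_nonneg hA p]
  · linarith [Real.self_le_rpow_of_one_le h hp]

theorem norm_intervalIntegral_div_sub_le {f : ℂ → ℂ} {z : ℂ} {x y Y : ℝ} {p : ℝ} (hp : 1 ≤ p)
    (hyY : y ≤ Y) (hx : |z.re| < |x|) (hf : ContinuousOn (fun s : ℝ => f (x + s * I)) (Icc y Y)) :
    ‖∫ s : ℝ in y..Y, f (x + s * I) / (x + s * I - z)‖ ≤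
      (Y - y + ∫ s in Ioc y Y, ‖f (x + s * I)‖ ^ p) / (|x| - |z.re|) := by
  have hpos : 0 < |x| - |z.re| := by linarith
  have hfi : IntegrableOn (fun s : ℝ => ‖f (x + s * I)‖ ^ p) (Ioc y Y) :=
    ((hf.norm.rpow_const fun _ _ => Or.inr (by linarith)).integrableOn_Icc).mono_set
      Ioc_subset_Icc_self
  have h1 : IntegrableOn (fun _ : ℝ => (1 : ℝ)) (Ioc y Y) := by simp
  rw [intervalIntegral.integral_of_le hyY]
  calc _ ≤ ∫ s in Ioc y Y, (1 + ‖f (x + s * I)‖ ^ p) / (|x| - |z.re|) := by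
        refine norm_integral_le_of_norm_le ((h1.add hfi).div_const _) (ae_of_all _ fun s => ?_)
        have hden : |x| - |z.re| ≤ ‖(x + s * I - z : ℂ)‖ := by
          refine le_trans ?_ (abs_re_le_norm _)
          simpa using abs_sub_abs_le_abs_sub x z.re
        rw [norm_div]
        gcongr
        exact le_one_add_rpow hp (norm_nonneg _)
    _ = _ := by
        rw [integral_div, integral_add h1 hfi]
        simp [hyY]

theorem tendsto_const_div_sub_atTop (C a : ℝ) :
    Tendsto (fun R : ℝ => C / (|R| - a)) atTop (𝓝 0) :=
  tendsto_const_nhds.div_atTop (tendsto_atTop_add_const_right _ _ tendsto_abs_atTop_atTop)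

theorem add_mul_I_sub_ne_zero {z : ℂ} {y : ℝ} (h : y ≠ z.im) (t : ℝ) : (t + y * I - z : ℂ) ≠ 0 :=
  fun h0 => h (by simpa [sub_eq_zero] using congrArg Complex.im h0)

/-- The truncated integral of `1 / (t - ζ)` as a difference of logarithms, where `k = ±I`
rotates the line of integration into the right half-plane. -/
theorem tendsto_intervalIntegral_one_div_sub {ζ k : ℂ} (hk : k * k = -1)
    (hre : ∀ t : ℝ, 0 < (k * (t - ζ)).re) :
    Tendsto (fun R : ℝ => ∫ t in (-R)..R, 1 / ((t : ℂ) - ζ)) atTop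
      (𝓝 (log k - log (-k))) := by
  have hk0 : k ≠ 0 := by rintro rfl; simp at hk
  have hne : ∀ t : ℝ, (t : ℂ) - ζ ≠ 0 := fun t h => by simpa [h] using hre t
  have hkim : k = I ∨ k = -I := by
    have : (k - I) * (k + I) = 0 := by ring_nf; rw [pow_two, hk]; simp
    rcases mul_eq_zero.1 this with h | h
    · exact Or.inl (sub_eq_zero.1 h)
    · exact Or.inr (eq_neg_of_add_eq_zero_left h)
  have hks : k ∈ slitPlane ∧ -k ∈ slitPlane := by
    rcases hkim with rfl | rfl <;> simp [mem_slitPlane_iff]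
  have hF : ∀ R : ℝ, ∫ t in (-R)..R, 1 / ((t : ℂ) - ζ) =
      log (k * ((R : ℝ) - ζ)) - log (k * ((-R : ℝ) - ζ)) := fun R => by
    refine intervalIntegral.integral_eq_sub_of_hasDerivAt
      (f := fun t : ℝ => log (k * ((t : ℂ) - ζ))) (fun t _ => ?_) ?_
    · have h1 : HasDerivAt (fun t : ℝ => k * ((t : ℂ) - ζ)) (k * 1) t :=
        ((Complex.ofRealCLM.hasDerivAt (x := t)).sub_const ζ).const_mul k
      have h2 := h1.clog_real (mem_slitPlane_iff.2 (Or.inl (hre t)))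
      rwa [mul_one, div_mul_cancel_left₀ hk0, ← one_div] at h2
    · exact (continuous_const.div (by fun_prop) hne).intervalIntegrable _ _
  have hinv : Tendsto (fun R : ℝ => ζ / (R : ℂ)) atTop (𝓝 0) := by
    have := (Complex.continuous_ofReal.tendsto 0).comp tendsto_inv_atTop_zero
    simpa [div_eq_mul_inv, Function.comp_def] using this.const_mul ζ
  have hl : Tendsto (fun R : ℝ => log (k * (1 - ζ / R)) - log (k * (-1 - ζ / R))) atTop
      (𝓝 (log k - log (-k))) := by
    refine Tendsto.sub (Tendsto.clog ?_ hks.1) (Tendsto.clog ?_ hks.2)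
    · simpa using ((tendsto_const_nhds (x := (1 : ℂ))).sub hinv).const_mul k
    · simpa using ((tendsto_const_nhds (x := (-1 : ℂ))).sub hinv).const_mul k
  refine hl.congr' ?_
  filter_upwards [eventually_gt_atTop 0] with R hR
  have hRc : (R : ℂ) ≠ 0 := by exact_mod_cast hR.ne'
  have e1 : k * ((R : ℝ) - ζ) = R * (k * (1 - ζ / R)) := by field_simp
  have e2 : k * ((-R : ℝ) - ζ) = R * (k * (-1 - ζ / R)) := by push_cast; field_simp
  have n1 : k * (1 - ζ / R) ≠ 0 := fun h => by simpa [e1, h] using hre R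
  have n2 : k * (-1 - ζ / R) ≠ 0 := fun h => by
    have := hre (-R)
    rw [e2, h] at this
    simp at this
  rw [hF, e1, e2, log_ofReal_mul hR n1, log_ofReal_mul hR n2]
  ring

theorem tendsto_rectIntegral_one_div_sub {z : ℂ} {y Y : ℝ} (hy : y < z.im) (hY : z.im < Y) :
    Tendsto (rectIntegral (fun w => 1 / (w - z)) y Y) atTop (𝓝 (2 * Real.pi * I)) := by
  have hbot : Tendsto (fun R : ℝ => ∫ x : ℝ in (-R)..R, 1 / ((x + y * I : ℂ) - z)) atTop
      (𝓝 (Real.pi * I)) := by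
    have h := tendsto_intervalIntegral_one_div_sub (ζ := z - y * I) (k := I) I_mul_I
      (fun t => by simpa using hy)
    rw [log_I, log_neg_I] at h
    convert h using 2
    · simp only [sub_sub_eq_add_sub]
    · ring
  have htop : Tendsto (fun R : ℝ => ∫ x : ℝ in (-R)..R, 1 / ((x + Y * I : ℂ) - z)) atTop
      (𝓝 (-(Real.pi * I))) := by
    have h := tendsto_intervalIntegral_one_div_sub (ζ := z - Y * I) (k := -I) (by simp)
      (fun t => by simpa using hY)
    rw [neg_neg, log_I, log_neg_I] at h
    convert h using 2
    · simp only [sub_sub_eq_add_sub]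
    · ring
  have hyY : y ≤ Y := (hy.trans hY).le
  have hside : ∀ σ : ℝ, |σ| = 1 → Tendsto (fun R : ℝ => I * ∫ s : ℝ in y..Y,
      1 / (((σ * R : ℝ) + s * I : ℂ) - z)) atTop (𝓝 0) := fun σ hσ => by
    refine squeeze_zero_norm' ?_ (tendsto_const_div_sub_atTop (Y - y + (Y - y)) |z.re|)
    filter_upwards [eventually_gt_atTop |z.re|] with R hR
    have hR' : |σ * R| = |R| := by rw [abs_mul, hσ, one_mul]
    have := norm_intervalIntegral_div_sub_le (f := fun _ => 1) (z := z) (x := σ * R) le_rfl hyY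
      (by rw [hR']; exact hR.trans_le (le_abs_self R)) continuousOn_const
    rw [hR'] at this
    simpa [hyY] using this
  have := ((hbot.sub htop).add (hside 1 (by simp))).sub (hside (-1) (by simp))
  convert this using 2
  · simp [rectIntegral]
  · ring

theorem rectIntegral_div_sub {f : ℂ → ℂ} {z : ℂ} {y Y R : ℝ} (hR : |z.re| < R) (hy : y < z.im)
    (hY : z.im < Y) {U : Set ℂ} (hU : IsOpen U) (hf : DifferentiableOn ℂ f U)
    (hs : {w : ℂ | y ≤ w.im ∧ w.im ≤ Y} ⊆ U) :
    rectIntegral (fun w => f w / (w - z)) y Y R =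
      f z * rectIntegral (fun w => 1 / (w - z)) y Y R := by
  have hzU : U ∈ 𝓝 z := hU.mem_nhds (hs ⟨hy.le, hY.le⟩)
  have hd : DifferentiableOn ℂ (dslope f z) U := (differentiableOn_dslope hzU).2 hf
  have h0 := rectIntegral_eq_zero (R := R) (hy.trans hY).le (hd.mono hs)
  have hside : ∀ (γ : ℝ → ℂ) (a b : ℝ), Continuous γ → (∀ t ∈ uIcc a b, γ t ∈ U) →
      (∀ t, γ t ≠ z) →
      ∫ t in a..b, dslope f z (γ t) =
        (∫ t in a..b, f (γ t) / (γ t - z)) - f z * ∫ t in a..b, 1 / (γ t - z) := by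
    intro γ a b hγ hγU hγz
    have hi : IntervalIntegrable (fun t => 1 / (γ t - z)) volume a b :=
      (continuous_const.div (by fun_prop) fun t => sub_ne_zero.2 (hγz t)).intervalIntegrable _ _
    have hi' : IntervalIntegrable (fun t => f (γ t) / (γ t - z)) volume a b :=
      ((hf.continuousOn.comp hγ.continuousOn hγU).div (by fun_prop)
        fun t _ => sub_ne_zero.2 (hγz t)).intervalIntegrable
    rw [← intervalIntegral.integral_const_mul, ← intervalIntegral.integral_sub hi' (hi.const_mul _)]
    refine intervalIntegral.integral_congr fun t _ => ?_
    simp only [dslope_of_ne f (hγz t), slope_def_field]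
    ring
  have hyY := (hy.trans hY).le
  have hne : ∀ c : ℝ, c ≠ z.im → ∀ t : ℝ, (t + c * I : ℂ) ≠ z := fun c hc t =>
    sub_ne_zero.1 (add_mul_I_sub_ne_zero hc t)
  have hne' : ∀ c : ℝ, c ≠ z.re → ∀ t : ℝ, (c + t * I : ℂ) ≠ z := fun c hc t h =>
    hc (by simpa using congrArg Complex.re h)
  rw [abs_lt] at hR
  simp only [rectIntegral] at h0 ⊢
  rw [hside (fun x : ℝ => x + y * I) _ _ (by fun_prop) (fun t _ => hs (by simp [hyY]))
      (hne y hy.ne),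
    hside (fun x : ℝ => x + Y * I) _ _ (by fun_prop) (fun t _ => hs (by simp [hyY]))
      (hne Y hY.ne'),
    hside (fun s : ℝ => R + s * I) _ _ (by fun_prop)
      (fun t ht => hs (by simpa [uIcc_of_le hyY] using ht)) (hne' R hR.2.ne'),
    hside (fun s : ℝ => (-R : ℝ) + s * I) _ _ (by fun_prop)
      (fun t ht => hs (by simpa [uIcc_of_le hyY] using ht)) (hne' (-R) (by linarith))] at h0
  linear_combination h0

theorem frequently_atTop_le_one_of_integrable {G : ℝ → ℝ} (hG : Integrable G) :
    ∃ᶠ R in atTop, G R ≤ 1 := by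
  intro h
  obtain ⟨R₀, hR₀⟩ := eventually_atTop.1 h
  have h1 := hG.measure_gt_lt_top one_pos
  have h2 : (⊤ : ENNReal) ≤ volume {a : ℝ | 1 < G a} := by
    rw [← Real.volume_Ici (a := R₀)]
    exact measure_mono fun R hR => not_le.1 (hR₀ R hR)
  exact absurd h1 (not_lt.2 h2)

theorem continuous_horizontal {f : ℂ → ℂ} (hf : ContinuousOn f {z : ℂ | 0 ≤ z.im}) {y : ℝ}
    (hy : 0 ≤ y) : Continuous fun t : ℝ => f (t + y * I) :=
  hf.comp_continuous (by fun_prop) fun t => by simpa using hy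

theorem integrable_strip_rpow {p : ℝ} (hp : 1 ≤ p) {f : ℂ → ℂ}
    (hf : ContinuousOn f {z : ℂ | 0 ≤ z.im}) {M : ℝ}
    (hM : ∀ y : ℝ, 0 < y → Integrable (fun x : ℝ => ‖f (x + y * I)‖ ^ p) ∧
      ∫ x : ℝ, ‖f (x + y * I)‖ ^ p ≤ M) {y Y : ℝ} (hy : 0 < y) :
    Integrable fun x : ℝ => ∫ s in Ioc y Y, ‖f (x + s * I)‖ ^ p := by
  have hmeas : AEStronglyMeasurable (fun q : ℝ × ℝ => ‖f (q.1 + q.2 * I)‖ ^ p)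
      ((volume : Measure ℝ).prod (volume.restrict (Ioc y Y))) := by
    have hc : ContinuousOn (fun q : ℝ × ℝ => ‖f (q.1 + q.2 * I)‖ ^ p) (univ ×ˢ Ioc y Y) := by
      refine ContinuousOn.rpow_const (ContinuousOn.norm ?_) fun _ _ => Or.inr (by linarith)
      exact hf.comp (by fun_prop) fun q hq => by simpa using (hy.trans hq.2.1).le
    have := hc.aestronglyMeasurable (μ := (volume : Measure ℝ).prod volume)
      (MeasurableSet.univ.prod measurableSet_Ioc)
    rwa [← Measure.prod_restrict, Measure.restrict_univ] at this
  have hnn : ∀ w : ℂ, 0 ≤ ‖f w‖ ^ p := fun w => by positivity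
  refine Integrable.integral_prod_left ((integrable_prod_iff' hmeas).2 ⟨?_, ?_⟩)
  · exact (ae_restrict_iff' measurableSet_Ioc).2
      (ae_of_all _ fun s hs => (hM s (hy.trans hs.1)).1)
  · refine Integrable.mono' (g := fun _ => M) (by simp) hmeas.norm.prod_swap.integral_prod_right' ?_
    refine (ae_restrict_iff' measurableSet_Ioc).2 (ae_of_all _ fun s hs => ?_)
    rw [Real.norm_of_nonneg (integral_nonneg fun _ => norm_nonneg _)]
    simpa only [Real.norm_of_nonneg (hnn _)] using (hM s (hy.trans hs.1)).2

theorem exists_norm_inv_sub_le (z : ℂ) {d : ℝ} (hd : 0 < d) :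
    ∃ c : ℝ, 0 < c ∧ ∀ y : ℝ, d ≤ |y - z.im| → ∀ t : ℝ,
      ‖(t + y * I - z : ℂ)⁻¹‖ ≤ c * (1 + ‖t‖)⁻¹ := by
  have hc : 0 < 1 + (1 + |z.re|) / d := by positivity
  refine ⟨_, hc, fun y hy t => ?_⟩
  have h1 : |t - z.re| ≤ ‖(t + y * I - z : ℂ)‖ := by
    simpa using abs_re_le_norm (t + y * I - z : ℂ)
  have h2 : d ≤ ‖(t + y * I - z : ℂ)‖ := hy.trans (by
    simpa using abs_im_le_norm (t + y * I - z : ℂ))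
  have h3 : |t| ≤ |t - z.re| + |z.re| := by simpa using abs_add_le (t - z.re) z.re
  have h4 : 1 + |z.re| ≤ (1 + |z.re|) / d * ‖(t + y * I - z : ℂ)‖ := by
    rw [div_mul_eq_mul_div, le_div_iff₀ hd]
    gcongr
  rw [norm_inv, ← div_eq_mul_inv, inv_eq_one_div, div_le_div_iff₀ (hd.trans_le h2) (by positivity),
    Real.norm_eq_abs]
  linarith

theorem tendsto_intervalIntegral_horizontal {E : Type*} [NormedAddCommGroup E] [NormedSpace ℝ E]
    {Φ : ℂ → E} {d : ℝ} (hd : 0 < d) (hΦ : ContinuousOn Φ {w : ℂ | 0 ≤ w.im ∧ w.im ≤ d})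
    (a b : ℝ) :
    Tendsto (fun y : ℝ => ∫ t : ℝ in a..b, Φ (t + y * I)) (𝓝[>] 0)
      (𝓝 (∫ t : ℝ in a..b, Φ t)) := by
  have hc : Continuous (Function.uncurry fun y t : ℝ => Φ (t + (max 0 (min y d) : ℝ) * I)) :=
    hΦ.comp_continuous (by fun_prop) fun q => by simp [hd.le]
  have h := ((intervalIntegral.continuous_parametric_intervalIntegral_of_continuous'
    (μ := volume) hc a b).tendsto 0).mono_left (nhdsWithin_le_nhds (s := Ioi 0))
  simp only [min_eq_left hd.le, max_self, ofReal_zero, zero_mul, add_zero] at h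
  refine h.congr' ?_
  filter_upwards [Ioo_mem_nhdsGT hd] with y hy
  rw [min_eq_left hy.2.le, max_eq_right hy.1.le]

section HardyBounds

variable {p : ℝ} {f : ℂ → ℂ} {M : ℝ}

theorem integrable_boundary_rpow (hp : 1 ≤ p) (hf : ContinuousOn f {z : ℂ | 0 ≤ z.im})
    (hM : ∀ y : ℝ, 0 < y → Integrable (fun x : ℝ => ‖f (x + y * I)‖ ^ p) ∧
      ∫ x : ℝ, ‖f (x + y * I)‖ ^ p ≤ M) :
    Integrable (fun x : ℝ => ‖f x‖ ^ p) ∧ ∫ x : ℝ, ‖f x‖ ^ p ≤ M := by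
  have hp0 : 0 ≤ p := by linarith
  have hnn : ∀ w : ℂ, 0 ≤ ‖f w‖ ^ p := fun w => by positivity
  have hb : ∀ N : ℝ, 0 ≤ N → ∫ t : ℝ in (-N)..N, ‖f t‖ ^ p ≤ M := fun N hN => by
    refine le_of_tendsto (tendsto_intervalIntegral_horizontal (Φ := fun w => ‖f w‖ ^ p) one_pos
      ((hf.mono fun w hw => hw.1).norm.rpow_const fun _ _ => Or.inr hp0) (-N) N) ?_
    filter_upwards [self_mem_nhdsWithin] with y hy
    rw [intervalIntegral.integral_of_le (by linarith)]
    exact (setIntegral_le_integral (hM y hy).1 (ae_of_all _ fun _ => hnn _)).trans (hM y hy).2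
  have hcont : Continuous fun t : ℝ => ‖f t‖ ^ p := by
    simpa using (continuous_horizontal hf le_rfl).norm.rpow_const fun _ => Or.inr hp0
  have hi : Integrable fun t : ℝ => ‖f t‖ ^ p := by
    refine integrable_of_intervalIntegral_norm_bounded (l := atTop) M
      (fun i => (hcont.integrableOn_Icc (a := -i) (b := i)).mono_set Ioc_subset_Icc_self)
      tendsto_neg_atTop_atBot tendsto_id ?_
    filter_upwards [eventually_ge_atTop 0] with N hN
    simpa only [Real.norm_of_nonneg (hnn _)] using hb N hN
  refine ⟨hi, le_of_tendsto
    (intervalIntegral_tendsto_integral hi tendsto_neg_atTop_atBot tendsto_id) ?_⟩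
  filter_upwards [eventually_ge_atTop 0] with N hN using hb N hN

theorem horizontal_cauchy_bounds (hf : ContinuousOn f {z : ℂ | 0 ≤ z.im})
    (hM : ∀ y : ℝ, 0 < y → Integrable (fun x : ℝ => ‖f (x + y * I)‖ ^ p) ∧
      ∫ x : ℝ, ‖f (x + y * I)‖ ^ p ≤ M) {z : ℂ} {c : ℝ} {y : ℝ} (hy : 0 < y) (hyz : y ≠ z.im)
    (hc : ∀ t : ℝ, ‖(t + y * I - z : ℂ)⁻¹‖ ≤ c * (1 + ‖t‖)⁻¹) :
    (∀ t : ℝ, 0 ≤ ‖f (t + y * I)‖) ∧ Integrable (fun t : ℝ => ‖f (t + y * I)‖ ^ p) ∧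
      ∫ t : ℝ, ‖f (t + y * I)‖ ^ p ≤ M ∧
      Continuous (fun t : ℝ => f (t + y * I) / (t + y * I - z)) ∧
      ∀ t : ℝ, ‖f (t + y * I) / (t + y * I - z)‖ ≤ ‖f (t + y * I)‖ * (c * (1 + ‖t‖)⁻¹) := by
  refine ⟨fun t => norm_nonneg _, (hM y hy).1, (hM y hy).2,
    (continuous_horizontal hf hy.le).div (by fun_prop) (add_mul_I_sub_ne_zero hyz), fun t => ?_⟩
  rw [div_eq_mul_inv, norm_mul]
  gcongr
  exact hc t

theorem horizontal_cauchy_sub (hp : 1 ≤ p) (hf : ContinuousOn f {z : ℂ | 0 ≤ z.im})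
    (hM : ∀ y : ℝ, 0 < y → Integrable (fun x : ℝ => ‖f (x + y * I)‖ ^ p) ∧
      ∫ x : ℝ, ‖f (x + y * I)‖ ^ p ≤ M) {z E : ℂ} {y Y : ℝ} (hy : 0 < y) (hyY : y < Y)
    (hyz : y ≠ z.im) (hYz : Y ≠ z.im)
    (hE : Tendsto (rectIntegral (fun w => f w / (w - z)) y Y) atTop (𝓝 E)) :
    (∫ t : ℝ, f (t + y * I) / (t + y * I - z)) - ∫ t : ℝ, f (t + Y * I) / (t + Y * I - z) = E := by
  have hline : ∀ η : ℝ, 0 < η → η ≠ z.im →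
      Tendsto (fun R : ℝ => ∫ t : ℝ in (-R)..R, f (t + η * I) / (t + η * I - z)) atTop
        (𝓝 (∫ t : ℝ, f (t + η * I) / (t + η * I - z))) := fun η hη hηz => by
    obtain ⟨c, hc, h⟩ := exists_norm_inv_sub_le z (abs_pos.2 (sub_ne_zero.2 hηz))
    obtain ⟨h1, h2, h3, h4, h5⟩ := horizontal_cauchy_bounds hf hM hη hηz (h η le_rfl)
    obtain ⟨N, -, hN⟩ := exists_uniform_tail hp hc M one_pos
    exact intervalIntegral_tendsto_integral (hN _ _ h1 h2 h3 h4 h5).1 tendsto_neg_atTop_atBot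
      tendsto_id
  set G : ℝ → ℝ := fun x => ∫ s in Ioc y Y, ‖f (x + s * I)‖ ^ p
  have hG0 : ∀ x, 0 ≤ G x := fun x => integral_nonneg fun s => by positivity
  have hG : Integrable G := integrable_strip_rpow hp hf hM hy
  have hfreq := frequently_atTop_le_one_of_integrable (hG.add hG.comp_neg)
  have hne : (atTop ⊓ 𝓟 {R | (G + fun R => G (-R)) R ≤ 1}).NeBot :=
    frequently_mem_iff_neBot.1 hfreq
  have hside : ∀ σ : ℝ, |σ| = 1 → (∀ R, G (σ * R) ≤ G R + G (-R)) →
      Tendsto (fun R : ℝ => I * ∫ s : ℝ in y..Y,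
        f ((σ * R : ℝ) + s * I) / ((σ * R : ℝ) + s * I - z))
        (atTop ⊓ 𝓟 {R | (G + fun R => G (-R)) R ≤ 1}) (𝓝 0) := fun σ hσ hσG => by
    refine squeeze_zero_norm' ?_
      ((tendsto_const_div_sub_atTop (Y - y + 1) |z.re|).mono_left inf_le_left)
    filter_upwards [Eventually.filter_mono inf_le_left (eventually_gt_atTop |z.re|),
      mem_inf_of_right (mem_principal_self _)] with R hR hR1
    have hR' : |σ * R| = |R| := by rw [abs_mul, hσ, one_mul]
    have hR2 : |z.re| < |R| := hR.trans_le (le_abs_self R)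
    have h := norm_intervalIntegral_div_sub_le (f := f) (z := z) (x := σ * R) hp hyY.le
      (by rwa [hR']) (hf.comp (by fun_prop) fun s hs => by simpa using hy.le.trans hs.1)
    rw [hR'] at h
    rw [norm_mul, norm_I, one_mul]
    refine h.trans ?_
    have h1 : G (σ * R) ≤ 1 := (hσG R).trans hR1
    have : 0 < |R| - |z.re| := by linarith
    gcongr
  have hlim := ((((hline y hy hyz).sub (hline Y (hy.trans hyY) hYz)).mono_left inf_le_left).add
    (hside 1 (by simp) fun R => by simpa using hG0 (-R))).sub
    (hside (-1) (by simp) fun R => by simpa using hG0 R)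
  rw [add_zero, sub_zero] at hlim
  refine tendsto_nhds_unique hlim ((hE.mono_left inf_le_left).congr fun R => ?_)
  simp [rectIntegral]

theorem tendsto_horizontal_cauchy_atTop (hp : 1 ≤ p) (hf : ContinuousOn f {z : ℂ | 0 ≤ z.im})
    (hM : ∀ y : ℝ, 0 < y → Integrable (fun x : ℝ => ‖f (x + y * I)‖ ^ p) ∧
      ∫ x : ℝ, ‖f (x + y * I)‖ ^ p ≤ M) (z : ℂ) :
    Tendsto (fun Y : ℝ => ∫ t : ℝ, f (t + Y * I) / (t + Y * I - z)) atTop (𝓝 0) := by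
  have hp0 : p ≠ 0 := by linarith
  have hM0 : 0 ≤ M := (integral_nonneg fun x => by positivity).trans (hM 1 one_pos).2
  obtain ⟨c, hc, h⟩ := exists_norm_inv_sub_le z one_pos
  have key := tendsto_integral_of_uniform_tail hp hc M (l := atTop)
    (A := fun (Y t : ℝ) => ‖f (t + Y * I)‖) (u := fun (Y t : ℝ) => f (t + Y * I) / (t + Y * I - z))
    (B := fun _ => 0) (v := fun _ => 0) ?_
    (by simpa [Real.zero_rpow hp0] using ⟨hM0, continuous_const⟩) ?_
  · simpa using key
  · filter_upwards [eventually_gt_atTop 0, eventually_ge_atTop (1 + z.im)] with Y hY hYz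
    exact horizontal_cauchy_bounds hf hM hY (by linarith)
      (h Y ((by linarith : 1 ≤ Y - z.im).trans (le_abs_self _)))
  · intro N hN
    rw [intervalIntegral.integral_zero]
    refine squeeze_zero_norm' ?_ (tendsto_const_nhds.div_atTop
      (tendsto_atTop_add_const_right atTop (-z.im) tendsto_id) : Tendsto (fun Y : ℝ =>
        (2 * N + M) / (Y + -z.im)) atTop (𝓝 0))
    filter_upwards [eventually_gt_atTop 0, eventually_gt_atTop z.im] with Y hY hYz
    have hpos : 0 < Y + -z.im := by linarith
    have hi := (hM Y hY).1
    have h1 : IntegrableOn (fun _ : ℝ => (1 : ℝ)) (Ioc (-N) N) := by simp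
    rw [intervalIntegral.integral_of_le (by linarith)]
    calc _ ≤ ∫ t : ℝ in Ioc (-N) N, (1 + ‖f (t + Y * I)‖ ^ p) / (Y + -z.im) := by
          refine norm_integral_le_of_norm_le ((h1.add hi.integrableOn).div_const _)
            (ae_of_all _ fun t => ?_)
          have hden : Y + -z.im ≤ ‖(t + Y * I - z : ℂ)‖ := by
            refine le_trans (le_abs_self _) ?_
            simpa [sub_eq_add_neg] using abs_im_le_norm (t + Y * I - z : ℂ)
          rw [norm_div]
          gcongr
          exact le_one_add_rpow hp (norm_nonneg _)
      _ = (2 * N + ∫ t : ℝ in Ioc (-N) N, ‖f (t + Y * I)‖ ^ p) / (Y + -z.im) := by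
          rw [integral_div, integral_add h1 hi.integrableOn]
          simp [hN.le, two_mul]
      _ ≤ _ := by
          gcongr
          exact (setIntegral_le_integral hi (ae_of_all _ fun _ => by positivity)).trans (hM Y hY).2

theorem tendsto_horizontal_cauchy_zero (hp : 1 ≤ p) (hf : ContinuousOn f {z : ℂ | 0 ≤ z.im})
    (hM : ∀ y : ℝ, 0 < y → Integrable (fun x : ℝ => ‖f (x + y * I)‖ ^ p) ∧
      ∫ x : ℝ, ‖f (x + y * I)‖ ^ p ≤ M) {z : ℂ} (hz : z.im ≠ 0) :
    Tendsto (fun y : ℝ => ∫ t : ℝ, f (t + y * I) / (t + y * I - z)) (𝓝[>] 0)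
      (𝓝 (∫ t : ℝ, f t / (t - z))) := by
  have hd : 0 < |z.im| / 2 := by positivity
  have hdist : ∀ y : ℝ, 0 ≤ y → y ≤ |z.im| / 2 → |z.im| / 2 ≤ |y - z.im| := fun y hy hyd => by
    have := abs_sub_abs_le_abs_sub z.im y
    rw [abs_sub_comm, abs_of_nonneg hy] at this
    linarith
  have hne : ∀ y : ℝ, 0 ≤ y → y ≤ |z.im| / 2 → y ≠ z.im := fun y hy hyd h => by
    have := hdist y hy hyd
    rw [h, sub_self, abs_zero] at this
    linarith
  obtain ⟨c, hc, h⟩ := exists_norm_inv_sub_le z hd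
  have hb := integrable_boundary_rpow hp hf hM
  have h0 : ∀ t : ℝ, (t - z : ℂ) ≠ 0 := fun t => by
    simpa using add_mul_I_sub_ne_zero (z := z) (y := 0) hz.symm t
  refine tendsto_integral_of_uniform_tail hp hc M (A := fun (y t : ℝ) => ‖f (t + y * I)‖)
    (B := fun t : ℝ => ‖f t‖) ?_ ⟨fun t => norm_nonneg _, hb.1, hb.2, ?_, fun t => ?_⟩ fun N _ => ?_
  · filter_upwards [Ioo_mem_nhdsGT hd] with y hy
    exact horizontal_cauchy_bounds hf hM hy.1 (hne y hy.1.le hy.2.le)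
      (h y (hdist y hy.1.le hy.2.le))
  · have := continuous_horizontal hf le_rfl
    simp only [ofReal_zero, zero_mul, add_zero] at this
    exact this.div (by fun_prop) h0
  · rw [div_eq_mul_inv, norm_mul]
    gcongr
    simpa using h 0 (hdist 0 le_rfl hd.le) t
  · refine tendsto_intervalIntegral_horizontal (Φ := fun w => f w / (w - z)) hd ?_ (-N) N
    refine (hf.mono fun w hw => hw.1).div (by fun_prop) fun w hw h => ?_
    exact hne w.im hw.1 hw.2 (by rw [sub_eq_zero.1 h])

theorem boundary_cauchy_eq (hp : 1 ≤ p) (hf : ContinuousOn f {z : ℂ | 0 ≤ z.im})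
    (hM : ∀ y : ℝ, 0 < y → Integrable (fun x : ℝ => ‖f (x + y * I)‖ ^ p) ∧
      ∫ x : ℝ, ‖f (x + y * I)‖ ^ p ≤ M) {z E : ℂ} (hz : z.im ≠ 0)
    (hE : ∀ᶠ y in 𝓝[>] (0 : ℝ), ∀ᶠ Y in atTop,
      Tendsto (rectIntegral (fun w => f w / (w - z)) y Y) atTop (𝓝 E)) :
    ∫ t : ℝ, f t / (t - z) = E := by
  have hnear : ∀ᶠ y in 𝓝[>] (0 : ℝ), y ≠ z.im :=
    (eventually_ne_nhds hz.symm).filter_mono nhdsWithin_le_nhds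
  refine tendsto_nhds_unique (tendsto_horizontal_cauchy_zero hp hf hM hz)
    (tendsto_const_nhds.congr' ?_)
  filter_upwards [hE, hnear, self_mem_nhdsWithin] with y hyE hyz hy
  refine tendsto_nhds_unique (f := fun _ : ℝ => E) (l := atTop) tendsto_const_nhds ?_
  have := (tendsto_const_nhds (x := ∫ t : ℝ, f (t + y * I) / (t + y * I - z))).sub
    (tendsto_horizontal_cauchy_atTop hp hf hM z)
  rw [sub_zero] at this
  refine this.congr' ?_
  filter_upwards [hyE, eventually_gt_atTop y, eventually_gt_atTop z.im] with Y hYE hyY hYz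
  exact horizontal_cauchy_sub hp hf hM hy hyY hyz hYz.ne' hYE

end HardyBounds

end Aux

/-- Titchmarsh theorem, upper half-plane: Cauchy representation for points in the
open upper half-plane, and vanishing of the Cauchy integral for points in the
open lower half-plane. -/
theorem titchmarsh_above (p : ℝ) (hp : 1 ≤ p) (f : ℂ → ℂ) (hf : HardyAbove p f) :
    (∀ z : ℂ, 0 < z.im →
      f z = (1 / (2 * Real.pi * Complex.I)) * ∫ t : ℝ, f t / (↑t - z)) ∧
    (∀ z : ℂ, z.im < 0 → ∫ t : ℝ, f t / (↑t - z) = 0) := by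
  obtain ⟨hd, hc, M, hM⟩ := hf
  constructor
  · intro z hz
    have key : ∫ t : ℝ, f t / (t - z) = f z * (2 * Real.pi * Complex.I) := by
      refine boundary_cauchy_eq hp hc hM hz.ne' ?_
      filter_upwards [Ioo_mem_nhdsGT hz] with y hy
      filter_upwards [eventually_gt_atTop z.im] with Y hY
      refine ((tendsto_rectIntegral_one_div_sub hy.2 hY).const_mul (f z)).congr' ?_
      filter_upwards [eventually_gt_atTop |z.re|] with R hR
      exact (rectIntegral_div_sub hR hy.2 hY (isOpen_lt continuous_const Complex.continuous_im) hd
        fun w hw => hy.1.trans_le hw.1).symm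
    rw [key]
    field_simp [Complex.two_pi_I_ne_zero]
  · intro z hz
    refine boundary_cauchy_eq hp hc hM hz.ne ?_
    filter_upwards [self_mem_nhdsWithin] with y hy
    filter_upwards [eventually_ge_atTop y] with Y hY
    refine tendsto_const_nhds.congr fun R => (rectIntegral_eq_zero hY ?_).symm
    refine (hd.mono fun w hw => lt_of_lt_of_le hy hw.1).div (by fun_prop) fun w hw h => ?_
    have h1 : w.im = z.im := by rw [sub_eq_zero.1 h]
    have h2 : y ≤ w.im := hw.1
    have h3 : 0 < y := hy
    linarith
end

section
/- Let 1 ≤ p < ∞ and let f be Hardy class from below of order p, with M = sup_{y<0} ∫_ℝ |f(x+iy)|^p dx. Then there exists a constant C (depending only on M and p) such that |f(x + iy)| ≤ C / |y|^{1/p} for all x ∈ ℝ and all y < 0. -/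
open MeasureTheory Filter

open Real in
/-- Jensen's inequality for the mean value property: `2π |f(c)|^p` is at most the integral of
`|f|^p` over a circle centred at `c`. -/
theorem DiffContOnCl.ofReal_two_pi_mul_norm_rpow_le {f : ℂ → ℂ} {c : ℂ} {s p : ℝ}
    (hp : 1 ≤ p) (hs : 0 ≤ s) (hf : DiffContOnCl ℂ f (Metric.ball c s)) :
    ENNReal.ofReal (2 * π * ‖f c‖ ^ p) ≤
      ∫⁻ θ in Set.Ioo (-π) π, ENNReal.ofReal (‖f (circleMap c s θ)‖ ^ p) := by
  have hπ : -π ≤ π := by linarith [pi_pos]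
  have hcont : Continuous fun θ => f (circleMap c s θ) :=
    hf.continuousOn_ball.comp_continuous (continuous_circleMap c s)
      fun θ => circleMap_mem_closedBall c hs θ
  have hcont_rpow : Continuous fun θ => ‖f (circleMap c s θ)‖ ^ p :=
    hcont.norm.rpow_const fun _ => .inr (by linarith)
  have hint {E : Type} [NormedAddCommGroup E] {g : ℝ → E} (hg : Continuous g) :
      IntegrableOn g (Set.Ioo (-π) π) :=
    (hg.integrableOn_Icc (a := -π) (b := π)).mono_set Set.Ioo_subset_Icc_self
  have hvol : volume.real (Set.Ioo (-π) π) = 2 * π := by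
    rw [Real.volume_real_Ioo_of_le hπ]; ring
  have hmean : f c = ⨍ θ in Set.Ioo (-π) π, f (circleMap c s θ) := by
    rw [← DiffContOnCl.circleAverage (f := f) (c := c) (R := s) (by rwa [abs_of_nonneg hs]),
      circleAverage_eq_integral_add (-π), setAverage_eq, hvol, ← integral_Ioc_eq_integral_Ioo,
      ← intervalIntegral.integral_of_le hπ,
      intervalIntegral.integral_comp_add_right (fun θ => f (circleMap c s θ))]
    congr 2 <;> ring
  have hnorm : ‖f c‖ ≤ ⨍ θ in Set.Ioo (-π) π, ‖f (circleMap c s θ)‖ := by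
    rw [hmean, setAverage_eq, setAverage_eq, norm_smul, smul_eq_mul, norm_inv, Real.norm_eq_abs,
      abs_of_nonneg measureReal_nonneg]
    gcongr
    exact norm_integral_le_integral_norm _
  have hjensen := (convexOn_rpow hp).map_set_average_le (μ := volume)
    (t := Set.Ioo (-π) π) (f := fun θ => ‖f (circleMap c s θ)‖)
    (continuousOn_id.rpow_const fun _ _ => .inr (by linarith)) isClosed_Ici
    (by simp [pi_pos]) (by simp) (.of_forall fun _ => norm_nonneg _) (hint hcont.norm)
    (hint hcont_rpow)
  have hle : ‖f c‖ ^ p ≤ ⨍ θ in Set.Ioo (-π) π, ‖f (circleMap c s θ)‖ ^ p :=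
    (rpow_le_rpow (norm_nonneg _) hnorm (by linarith)).trans hjensen
  rw [← ofReal_integral_eq_lintegral_ofReal (hint hcont_rpow)
    (.of_forall fun _ => by positivity)]
  refine ENNReal.ofReal_le_ofReal ?_
  rw [setAverage_eq, hvol, smul_eq_mul, inv_mul_eq_div, le_div_iff₀ (by positivity)] at hle
  linarith

open Real in
/-- Integration in polar coordinates around `c` over the disc of radius `R`. -/
theorem lintegral_mul_lintegral_circleMap_le {G : ℂ → ENNReal} (hG : Measurable G) (c : ℂ)
    (R : ℝ) :
    ∫⁻ s in Set.Ioo 0 R, ENNReal.ofReal s * ∫⁻ θ in Set.Ioo (-π) π, G (circleMap c s θ) ≤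
      ∫⁻ w, G w := by
  have hmap : Measurable fun q : ℝ × ℝ => circleMap c q.1 q.2 := by
    unfold circleMap; fun_prop
  have hmeas (s : ℝ) : Measurable fun θ => G (circleMap c s θ) :=
    hG.comp (continuous_circleMap c s).measurable
  calc
    _ = ∫⁻ q in Set.Ioo 0 R ×ˢ Set.Ioo (-π) π,
          ENNReal.ofReal q.1 * G (circleMap c q.1 q.2) := by
      rw [Measure.volume_eq_prod, ← Measure.prod_restrict, lintegral_prod _
        (by fun_prop)]
      simp_rw [lintegral_const_mul _ (hmeas _)]
    _ ≤ ∫⁻ q in polarCoord.target, ENNReal.ofReal q.1 • G (c + Complex.polarCoord.symm q) := by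
      simp only [Complex.polarCoord_symm_apply, circleMap, Complex.exp_mul_I,
        ← Complex.ofReal_cos, ← Complex.ofReal_sin, smul_eq_mul]
      exact lintegral_mono_set (Set.prod_mono Set.Ioo_subset_Ioi_self le_rfl)
    _ = ∫⁻ w, G (c + w) := Complex.lintegral_comp_polarCoord_symm fun w => G (c + w)
    _ = ∫⁻ w, G w := lintegral_add_left_eq_self G c

/-- Tonelli's theorem on `ℂ`, integrating over horizontal lines first. -/
theorem Complex.lintegral_eq_lintegral_im_re {G : ℂ → ENNReal} (hG : Measurable G) :
    ∫⁻ w, G w = ∫⁻ t : ℝ, ∫⁻ x : ℝ, G (x + t * Complex.I) := by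
  rw [← Complex.volume_preserving_equiv_real_prod.symm.lintegral_comp_emb
    Complex.measurableEquivRealProd.symm.measurableEmbedding, Measure.volume_eq_prod,
    lintegral_prod_symm _ (by fun_prop)]
  simp only [Complex.measurableEquivRealProd_symm_apply, Complex.mk_eq_add_mul_I]

theorem lintegral_Ioo_zero_ofReal {R : ℝ} (hR : 0 ≤ R) :
    ∫⁻ s in Set.Ioo 0 R, ENNReal.ofReal s = ENNReal.ofReal (R ^ 2 / 2) := by
  rw [← ofReal_integral_eq_lintegral_ofReal
    ((continuous_id'.integrableOn_Icc (a := 0) (b := R)).mono_set Set.Ioo_subset_Icc_self)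
    ((ae_restrict_iff' measurableSet_Ioo).2 (.of_forall fun _ hs => hs.1.le)),
    ← integral_Ioc_eq_integral_Ioo, ← intervalIntegral.integral_of_le hR]
  simp

/-- Pointwise growth bound for Hardy class functions from below: if the horizontal
`L^p` norms are bounded by `M`, then `|f(x+iy)| ≤ C / |y|^(1/p)` for a constant `C`
depending only on `M` and `p`. -/
theorem hardyBelow_pointwise_bound (p : ℝ) (hp : 1 ≤ p) (M : ℝ) :
    ∃ C : ℝ, ∀ f : ℂ → ℂ,
      DifferentiableOn ℂ f {z : ℂ | z.im < 0} →
      ContinuousOn f {z : ℂ | z.im ≤ 0} →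
      (∀ y : ℝ, y < 0 →
        Integrable (fun x : ℝ => ‖f (↑x + ↑y * Complex.I)‖ ^ p) ∧
        ∫ x : ℝ, ‖f (↑x + ↑y * Complex.I)‖ ^ p ≤ M) →
      ∀ (x y : ℝ), y < 0 → ‖f (↑x + ↑y * Complex.I)‖ ≤ C / |y| ^ (1 / p) := by
  refine ⟨(2 * M / Real.pi) ^ (1 / p), fun f hf _ hM x y hy => ?_⟩
  have hπ := Real.pi_pos
  have hM0 : 0 ≤ M := (integral_nonneg fun _ => by positivity).trans (hM y hy).2
  set c : ℂ := x + y * Complex.I with hc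
  have hcim : c.im = y := by simp [hc]
  set R := -y with hR
  have hR0 : 0 < R := by linarith
  set S : Set ℂ := {w | w.im ∈ Set.Ioo (2 * y) 0} with hS
  have hSm : MeasurableSet S := Complex.measurable_im measurableSet_Ioo
  set G : ℂ → ENNReal := S.indicator fun w => ENNReal.ofReal (‖f w‖ ^ p)
  have hfS : ContinuousOn f S := hf.continuousOn.mono fun w hw => hw.2
  have hG : Measurable G := by
    classical
    rw [show G = S.piecewise (fun w => ENNReal.ofReal (‖f w‖ ^ p)) fun _ => 0 from
      Set.piecewise_eq_indicator.symm]
    exact (ENNReal.continuous_ofReal.comp_continuousOn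
      (hfS.norm.rpow_const fun _ _ => .inr (by linarith))).measurable_piecewise
        continuousOn_const hSm
  have hball {w : ℂ} (hw : w ∈ Metric.ball c R) : w ∈ S := by
    have := (Complex.abs_im_le_norm (w - c)).trans_lt (mem_ball_iff_norm.1 hw)
    rw [Complex.sub_im, hcim, abs_lt] at this
    exact ⟨by linarith, by linarith⟩
  have hlower : ENNReal.ofReal (R ^ 2 / 2) * ENNReal.ofReal (2 * Real.pi * ‖f c‖ ^ p) ≤
      ∫⁻ w, G w := by
    rw [← lintegral_Ioo_zero_ofReal hR0.le, ← lintegral_mul_const _ (by fun_prop)]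
    refine le_trans (setLIntegral_mono' measurableSet_Ioo fun s hs => ?_)
      (lintegral_mul_lintegral_circleMap_le hG c R)
    gcongr
    have hsub : Metric.closedBall c s ⊆ Metric.ball c R := Metric.closedBall_subset_ball hs.2
    refine (DiffContOnCl.ofReal_two_pi_mul_norm_rpow_le hp hs.1.le
      (hf.diffContOnCl_ball fun w hw => (hball (hsub hw)).2)).trans ?_
    refine lintegral_mono fun θ => ?_
    simp only [G, le_refl,
      Set.indicator_of_mem (hball (hsub (circleMap_mem_closedBall c hs.1.le θ)))]
  have hupper : ∫⁻ w, G w ≤ ENNReal.ofReal (2 * R * M) := by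
    rw [Complex.lintegral_eq_lintegral_im_re hG]
    calc
      _ ≤ ∫⁻ t, (Set.Ioo (2 * y) 0).indicator (fun _ => ENNReal.ofReal M) t := by
        refine lintegral_mono fun t => ?_
        by_cases ht : t ∈ Set.Ioo (2 * y) 0
        · have hmem (u : ℝ) : (u + t * Complex.I : ℂ) ∈ S := by simpa [hS] using ht
          simp only [G, Set.indicator_of_mem (hmem _), Set.indicator_of_mem ht]
          rw [← ofReal_integral_eq_lintegral_ofReal (hM t ht.2).1
            (.of_forall fun _ => by positivity)]
          exact ENNReal.ofReal_le_ofReal (hM t ht.2).2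
        · have hmem (u : ℝ) : (u + t * Complex.I : ℂ) ∉ S := by simpa [hS] using ht
          simp [G, Set.indicator_of_notMem (hmem _)]
      _ = ENNReal.ofReal (2 * R * M) := by
        rw [lintegral_indicator_const measurableSet_Ioo, Real.volume_Ioo,
          ← ENNReal.ofReal_mul hM0, hR]
        congr 1; ring
  have hreal : R ^ 2 / 2 * (2 * Real.pi * ‖f c‖ ^ p) ≤ 2 * R * M := by
    have := hlower.trans hupper
    rwa [← ENNReal.ofReal_mul (by positivity),
      ENNReal.ofReal_le_ofReal_iff (by positivity)] at this
  have hpow : ‖f c‖ ^ p ≤ 2 * M / Real.pi / R := by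
    rw [div_div, le_div_iff₀ (by positivity)]
    refine le_of_mul_le_mul_left ?_ hR0
    linarith
  rw [abs_of_neg hy, ← Real.div_rpow (by positivity) hR0.le, one_div,
    Real.le_rpow_inv_iff_of_pos (norm_nonneg _) (by positivity) (by linarith)]
  exact hpow
end

section
/- Let 1 ≤ p < ∞ and let f be Hardy class from below of order p. For r > 0 let C_r be the arc {−r e^{iθ} : 1/r ≤ θ ≤ π − 1/r} in the open lower half-plane. Then the integral of |f(z)/z| with respect to arc length along C_r, namely ∫_{1/r}^{π−1/r} |f(−r e^{iθ})| dθ, tends to 0 as r → ∞. -/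
open MeasureTheory Filter

/-- The area mean value property on a disc. -/
theorem setIntegral_ball_eq_of_differentiableOn {f : ℂ → ℂ} {c : ℂ} {R : ℝ} (hR : 0 ≤ R)
    (hf : DifferentiableOn ℂ f (Metric.closedBall c R)) :
    ∫ z in Metric.ball c R, f z = (Real.pi * R ^ 2 : ℝ) • f c := by
  have hcircle : ∀ ρ ∈ Set.Ioo 0 R,
      ∫ θ in Set.Ioo (-Real.pi) Real.pi, f (circleMap c ρ θ) = (2 * Real.pi) • f c := by
    intro ρ hρ
    have hsub : Metric.closedBall c ρ ⊆ Metric.closedBall c R :=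
      Metric.closedBall_subset_closedBall hρ.2.le
    have hmean : Real.circleAverage f c ρ = f c := by
      refine DiffContOnCl.circleAverage (DifferentiableOn.diffContOnCl ?_)
      rw [abs_of_pos hρ.1]
      exact hf.mono ((Metric.closure_ball_subset_closedBall).trans hsub)
    rw [← integral_Ioc_eq_integral_Ioo,
      ← intervalIntegral.integral_of_le (by linarith [Real.pi_pos])]
    have hper := ((periodic_circleMap c ρ).comp f).intervalIntegral_add_eq (-Real.pi) 0
    simp only [Function.comp_def] at hper
    rw [show -Real.pi + 2 * Real.pi = Real.pi by ring, zero_add] at hper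
    rw [hper, ← hmean, Real.circleAverage_def, smul_smul, mul_inv_cancel₀ (by positivity),
      one_smul]
  have hint : IntegrableOn (fun q : ℝ × ℝ ↦ q.1 • f (circleMap c q.1 q.2))
      (Set.Ioo 0 R ×ˢ Set.Ioo (-Real.pi) Real.pi) := by
    refine IntegrableOn.mono_set (t := Set.Icc 0 R ×ˢ Set.Icc (-Real.pi) Real.pi) ?_
      (Set.prod_mono Set.Ioo_subset_Icc_self Set.Ioo_subset_Icc_self)
    refine ContinuousOn.integrableOn_compact (isCompact_Icc.prod isCompact_Icc) ?_
    refine continuous_fst.continuousOn.smul (hf.continuousOn.comp ?_ ?_)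
    · unfold circleMap; fun_prop
    · rintro ⟨ρ, θ⟩ ⟨hρ, -⟩
      simp only [Set.mem_Icc] at hρ
      simpa [circleMap, abs_of_nonneg hρ.1] using hρ.2
  calc ∫ z in Metric.ball c R, f z
      = ∫ z, (Metric.ball c R).indicator f (c + z) := by
        rw [integral_add_left_eq_self, integral_indicator Metric.isOpen_ball.measurableSet]
    _ = ∫ q in polarCoord.target, (Set.Ioo 0 R ×ˢ Set.Ioo (-Real.pi) Real.pi).indicator
          (fun q : ℝ × ℝ ↦ q.1 • f (circleMap c q.1 q.2)) q := by
        rw [← Complex.integral_comp_polarCoord_symm]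
        refine setIntegral_congr_fun polarCoord.open_target.measurableSet ?_
        rintro ⟨ρ, θ⟩ ⟨hρ, hθ⟩
        have hρ' : 0 < ρ := hρ
        have hmap : c + Complex.polarCoord.symm (ρ, θ) = circleMap c ρ θ := by
          simp [circleMap, Complex.exp_mul_I]
        have hmem : circleMap c ρ θ ∈ Metric.ball c R ↔ ρ < R := by
          simp [circleMap, abs_of_pos hρ']
        simp only [hmap]
        by_cases h : ρ < R
        · rw [Set.indicator_of_mem (hmem.2 h),
            Set.indicator_of_mem (show (ρ, θ) ∈ Set.Ioo 0 R ×ˢ _ from ⟨⟨hρ', h⟩, hθ⟩)]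
        · rw [Set.indicator_of_notMem (mt hmem.1 h), smul_zero,
            Set.indicator_of_notMem (fun hq ↦ h hq.1.2)]
    _ = ∫ q in Set.Ioo 0 R ×ˢ Set.Ioo (-Real.pi) Real.pi, q.1 • f (circleMap c q.1 q.2) := by
        rw [setIntegral_indicator (measurableSet_Ioo.prod measurableSet_Ioo), polarCoord_target,
          Set.inter_eq_self_of_subset_right
            (Set.prod_mono Set.Ioo_subset_Ioi_self subset_rfl)]
    _ = ∫ ρ in Set.Ioo 0 R, ρ • (2 * Real.pi) • f c := by
        rw [Measure.volume_eq_prod] at hint ⊢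
        rw [setIntegral_prod _ hint]
        refine setIntegral_congr_fun measurableSet_Ioo fun ρ hρ ↦ ?_
        simp only [integral_smul, hcircle ρ hρ]
    _ = (Real.pi * R ^ 2 : ℝ) • f c := by
        rw [integral_smul_const, ← integral_Ioc_eq_integral_Ioo,
          ← intervalIntegral.integral_of_le hR, integral_id, smul_smul]
        congr 1
        ring

/-- The elementary inequality behind Chebyshev's estimate of an `L¹` mean by an `L^p` mean. -/
theorem Real.le_add_rpow_mul_rpow {p ε t : ℝ} (hp : 1 ≤ p) (hε : 0 < ε) (ht : 0 ≤ t) :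
    t ≤ ε + ε ^ (1 - p) * t ^ p := by
  rcases le_or_gt t ε with h | h
  · have : 0 ≤ ε ^ (1 - p) * t ^ p := by positivity
    linarith
  · have ht' : 0 < t := hε.trans h
    calc t = t ^ (1 - p) * t ^ p := by rw [← Real.rpow_add ht']; simp
      _ ≤ ε ^ (1 - p) * t ^ p :=
        mul_le_mul_of_nonneg_right
          (Real.rpow_le_rpow_of_nonpos hε h.le (by linarith)) (by positivity)
      _ ≤ ε + ε ^ (1 - p) * t ^ p := by linarith

theorem setIntegral_ball_norm_rpow_le {p M R : ℝ} {f : ℂ → ℂ} {c : ℂ} (hp : 0 ≤ p)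
    (hR : 0 ≤ R) (hRc : R < -c.im) (hf : ContinuousOn f {z : ℂ | z.im ≤ 0})
    (hM : ∀ y : ℝ, y < 0 → Integrable (fun x : ℝ => ‖f (↑x + ↑y * Complex.I)‖ ^ p) ∧
      ∫ x : ℝ, ‖f (↑x + ↑y * Complex.I)‖ ^ p ≤ M) :
    ∫ z in Metric.ball c R, ‖f z‖ ^ p ≤ 2 * R * M := by
  set s := Set.Icc (c.re - R) (c.re + R)
  set t := Set.Icc (c.im - R) (c.im + R)
  set g : ℝ × ℝ → ℝ := fun q ↦ ‖f (↑q.1 + ↑q.2 * Complex.I)‖ ^ p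
  have hneg : ∀ y ∈ t, y < 0 := fun y hy ↦ by linarith [hy.2]
  have hg : IntegrableOn g (s ×ˢ t) := by
    refine ContinuousOn.integrableOn_compact (isCompact_Icc.prod isCompact_Icc) ?_
    refine ContinuousOn.rpow_const (ContinuousOn.norm (hf.comp (by fun_prop) ?_))
      fun _ _ ↦ Or.inr hp
    rintro ⟨x, y⟩ ⟨-, hy⟩
    simpa using (hneg y hy).le
  have hball : Complex.measurableEquivRealProd.symm ⁻¹' Metric.ball c R ⊆ s ×ˢ t := by
    rintro ⟨x, y⟩ hxy
    rw [Set.mem_preimage, Metric.mem_ball, dist_eq_norm] at hxy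
    have hre := (Complex.abs_re_le_norm _).trans hxy.le
    have him := (Complex.abs_im_le_norm _).trans hxy.le
    simp only [Complex.sub_re, Complex.sub_im,
      Complex.measurableEquivRealProd_symm_apply, abs_le] at hre him
    exact ⟨⟨by linarith, by linarith⟩, ⟨by linarith, by linarith⟩⟩
  calc ∫ z in Metric.ball c R, ‖f z‖ ^ p
      = ∫ q in Complex.measurableEquivRealProd.symm ⁻¹' Metric.ball c R, g q := by
        rw [← Complex.volume_preserving_equiv_real_prod.symm.setIntegral_preimage_emb
          Complex.measurableEquivRealProd.symm.measurableEmbedding]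
        simp only [Complex.measurableEquivRealProd_symm_apply, Complex.mk_eq_add_mul_I, g]
    _ ≤ ∫ q in s ×ˢ t, g q :=
        setIntegral_mono_set hg (Eventually.of_forall fun _ ↦ by positivity)
          hball.eventuallyLE
    _ = ∫ y in t, ∫ x in s, g (x, y) := by
        rw [Measure.volume_eq_prod] at hg ⊢
        rw [← setIntegral_prod_swap]
        exact setIntegral_prod _ hg.swap
    _ ≤ ∫ _y in t, M := by
        refine setIntegral_mono_on ?_ (by simp [t]) measurableSet_Icc fun y hy ↦ ?_
        · rw [Measure.volume_eq_prod] at hg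
          have := hg.swap
          rw [IntegrableOn, ← Measure.prod_restrict] at this
          exact this.integral_prod_left
        · exact (setIntegral_le_integral (hM y (hneg y hy)).1
            (Eventually.of_forall fun _ ↦ by positivity)).trans (hM y (hneg y hy)).2
    _ = 2 * R * M := by
        simp only [t, setIntegral_const, Real.volume_real_Icc, smul_eq_mul]
        rw [max_eq_left (by linarith)]
        ring

theorem HardyBelow.exists_norm_le {p : ℝ} (hp : 1 ≤ p) {f : ℂ → ℂ} (hf : HardyBelow p f)
    {ε : ℝ} (hε : 0 < ε) :
    ∃ K : ℝ, 0 ≤ K ∧ ∀ z : ℂ, z.im < 0 → ‖f z‖ ≤ ε + K / -z.im := by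
  obtain ⟨hdiff, hcont, M, hM⟩ := hf
  have hM0 : 0 ≤ M := (integral_nonneg fun _ ↦ by positivity).trans (hM (-1) (by norm_num)).2
  refine ⟨ε ^ (1 - p) * (4 * M) / Real.pi, by positivity, fun c hc ↦ ?_⟩
  set R := -c.im / 2 with hRdef
  have hR : 0 < R := by linarith
  have hRc : R < -c.im := by linarith
  have hsub : Metric.closedBall c R ⊆ {z : ℂ | z.im < 0} := by
    intro z hz
    rw [Metric.mem_closedBall, dist_eq_norm] at hz
    have him := (le_abs_self _).trans ((Complex.abs_im_le_norm _).trans hz)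
    rw [Complex.sub_im] at him
    show z.im < 0
    linarith
  have hfc : ContinuousOn f (Metric.closedBall c R) := (hdiff.mono hsub).continuousOn
  have hball : ∀ {g : ℂ → ℝ}, ContinuousOn g (Metric.closedBall c R) →
      IntegrableOn g (Metric.ball c R) := fun hg ↦
    (hg.integrableOn_compact (isCompact_closedBall c R)).mono_set Metric.ball_subset_closedBall
  have hpow : IntegrableOn (fun z ↦ ‖f z‖ ^ p) (Metric.ball c R) :=
    hball (hfc.norm.rpow_const fun _ _ ↦ Or.inr (by linarith))
  have hvol : volume.real (Metric.ball c R) = Real.pi * R ^ 2 := by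
    simp [measureReal_def, Complex.volume_ball, hR.le, mul_comm]
  have key : Real.pi * R ^ 2 * ‖f c‖ ≤
      Real.pi * R ^ 2 * ε + ε ^ (1 - p) * (2 * R * M) := by
    calc Real.pi * R ^ 2 * ‖f c‖ = ‖∫ z in Metric.ball c R, f z‖ := by
          rw [setIntegral_ball_eq_of_differentiableOn hR.le (hdiff.mono hsub), norm_smul,
            Real.norm_of_nonneg (by positivity)]
      _ ≤ ∫ z in Metric.ball c R, ‖f z‖ := norm_integral_le_integral_norm _
      _ ≤ ∫ z in Metric.ball c R, (ε + ε ^ (1 - p) * ‖f z‖ ^ p) :=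
          integral_mono (hball hfc.norm)
            ((hball continuousOn_const).add (hpow.const_mul _))
            fun z ↦ Real.le_add_rpow_mul_rpow hp hε (norm_nonneg _)
      _ = Real.pi * R ^ 2 * ε + ε ^ (1 - p) * ∫ z in Metric.ball c R, ‖f z‖ ^ p := by
          rw [integral_add (hball continuousOn_const) (hpow.const_mul _), setIntegral_const,
            hvol, integral_const_mul, smul_eq_mul]
      _ ≤ _ := by
          gcongr
          exact setIntegral_ball_norm_rpow_le (by linarith) hR.le hRc hcont hM
  have him : -c.im = 2 * R := by linarith
  refine le_of_mul_le_mul_left (key.trans_eq ?_) (by positivity : 0 < Real.pi * R ^ 2)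
  rw [him]
  field_simp
  ring

theorem HardyBelow.tendsto_zero {p : ℝ} (hp : 1 ≤ p) {f : ℂ → ℂ} (hf : HardyBelow p f) :
    Tendsto f (comap Complex.im atBot) (nhds 0) := by
  rw [Metric.tendsto_nhds]
  intro ε hε
  obtain ⟨K, -, hK⟩ := hf.exists_norm_le hp (half_pos hε)
  have hlim : Tendsto (fun z : ℂ ↦ K / -z.im) (comap Complex.im atBot) (nhds 0) :=
    (tendsto_neg_atBot_atTop.comp tendsto_comap).const_div_atTop K
  filter_upwards [hlim.eventually_lt_const (half_pos hε),
    tendsto_comap.eventually (eventually_lt_atBot 0)] with z hz hz0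
  rw [dist_zero_right]
  linarith [hK z hz0]

theorem Real.two_div_pi_le_mul_sin_of_mem_Icc {r θ : ℝ} (hr : 0 < r)
    (hθ : θ ∈ Set.Icc (1 / r) (Real.pi - 1 / r)) : 2 / Real.pi ≤ r * Real.sin θ := by
  have hr' : 0 < 1 / r := by positivity
  have hsin : 2 / Real.pi * (1 / r) ≤ Real.sin θ := by
    rcases le_total θ (Real.pi / 2) with h | h
    · exact (mul_le_mul_of_nonneg_left hθ.1 (by positivity)).trans
        (Real.mul_le_sin (by linarith [hθ.1]) h)
    · rw [← Real.sin_pi_sub]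
      exact (mul_le_mul_of_nonneg_left (by linarith [hθ.2]) (by positivity)).trans
        (Real.mul_le_sin (by linarith [hθ.2]) (by linarith))
  calc 2 / Real.pi = r * (2 / Real.pi * (1 / r)) := by field_simp
    _ ≤ r * Real.sin θ := by gcongr

/-- The arc integrals of `|f(z)/z|` along the lower-half-plane arcs
`C_r = {-r e^{iθ} : 1/r ≤ θ ≤ π - 1/r}`, namely `∫_{1/r}^{π-1/r} |f(-r e^{iθ})| dθ`,
tend to `0` as `r → ∞`. -/
theorem hardyBelow_arc_integral_tendsto_zero (p : ℝ) (hp : 1 ≤ p) (f : ℂ → ℂ)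
    (hf : HardyBelow p f) :
    Tendsto (fun r : ℝ =>
        ∫ θ in (1 / r)..(Real.pi - 1 / r),
          ‖f (-(↑r * Complex.exp (↑θ * Complex.I)))‖)
      atTop (nhds 0) := by
  obtain ⟨K, hK0, hK⟩ := hf.exists_norm_le hp one_pos
  set A : ℝ → Set ℝ := fun r ↦ Set.Ioc (1 / r) (Real.pi - 1 / r)
  set F : ℝ → ℝ → ℝ := fun r θ ↦ ‖f (-(↑r * Complex.exp (↑θ * Complex.I)))‖
  have him : ∀ r θ : ℝ, (-(↑r * Complex.exp (↑θ * Complex.I)) : ℂ).im = -(r * Real.sin θ) := by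
    intro r θ
    simp [Complex.exp_ofReal_mul_I_im]
  have hlow : ∀ r : ℝ, 1 ≤ r → ∀ θ ∈ A r, 2 / Real.pi ≤ r * Real.sin θ := fun r hr θ hθ ↦
    Real.two_div_pi_le_mul_sin_of_mem_Icc (by linarith) (Set.Ioc_subset_Icc_self hθ)
  have hpos : 0 < 2 / Real.pi := by positivity
  have hAsub : ∀ r : ℝ, 1 ≤ r → A r ⊆ Set.Ioo 0 Real.pi := fun r hr θ hθ ↦ by
    have : 0 < 1 / r := by positivity
    exact ⟨by linarith [hθ.1], by linarith [hθ.2]⟩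
  have heq : ∀ᶠ r : ℝ in atTop,
      ∫ θ in Set.Ioo 0 Real.pi, (A r).indicator (F r) θ =
        ∫ θ in (1 / r)..(Real.pi - 1 / r), F r θ := by
    filter_upwards [eventually_ge_atTop 1] with r hr
    have : 1 / r ≤ 1 := by rw [div_le_one (by linarith)]; exact hr
    rw [intervalIntegral.integral_of_le (by linarith [Real.pi_gt_three]),
      setIntegral_indicator measurableSet_Ioc,
      Set.inter_eq_self_of_subset_right (hAsub r hr)]
  refine Tendsto.congr' heq ?_
  suffices h : Tendsto (fun r ↦ ∫ θ in Set.Ioo 0 Real.pi, (A r).indicator (F r) θ) atTop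
      (nhds (∫ _θ in Set.Ioo 0 Real.pi, (0 : ℝ))) by
    rwa [integral_zero] at h
  refine tendsto_integral_filter_of_dominated_convergence
    (fun _ ↦ 1 + K / (2 / Real.pi)) ?_ ?_ (integrable_const _) ?_
  · filter_upwards [eventually_ge_atTop 1] with r hr
    refine AEStronglyMeasurable.mono_measure ?_ Measure.restrict_le_self
    rw [aestronglyMeasurable_indicator_iff measurableSet_Ioc]
    refine ContinuousOn.aestronglyMeasurable ?_ measurableSet_Ioc
    refine (hf.1.continuousOn.comp (by fun_prop) fun θ hθ ↦ ?_).norm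
    show Complex.im _ < 0
    rw [him]
    linarith [hlow r hr θ hθ]
  · filter_upwards [eventually_ge_atTop 1] with r hr
    refine Eventually.of_forall fun θ ↦ ?_
    by_cases hθ : θ ∈ A r
    · have h := hlow r hr θ hθ
      have hb := hK (-(↑r * Complex.exp (↑θ * Complex.I))) (by rw [him]; linarith)
      rw [him, neg_neg] at hb
      rw [Set.indicator_of_mem hθ, norm_norm]
      exact hb.trans (by gcongr)
    · rw [Set.indicator_of_notMem hθ, norm_zero]
      positivity
  · filter_upwards [ae_restrict_mem measurableSet_Ioo] with θ hθ
    have hF : Tendsto (fun r ↦ F r θ) atTop (nhds 0) := by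
      refine tendsto_zero_iff_norm_tendsto_zero.1 ((hf.tendsto_zero hp).comp
        (tendsto_comap_iff.2 (show Tendsto (Complex.im ∘ fun r : ℝ ↦
          (-(↑r * Complex.exp (↑θ * Complex.I)) : ℂ)) atTop atBot from ?_)))
      simp only [Function.comp_def, him]
      exact tendsto_neg_atTop_atBot.comp
        (tendsto_id.atTop_mul_const (Real.sin_pos_of_pos_of_lt_pi hθ.1 hθ.2))
    exact squeeze_zero (fun r ↦ Set.indicator_nonneg (fun _ _ ↦ norm_nonneg _) θ)
      (fun r ↦ Set.indicator_le_self' (fun _ _ ↦ norm_nonneg _) θ) hF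
end

section
/- Let f and g each be Hardy class from below of order 2, and suppose the restrictions of f and of g to the real axis are Schwartz functions. For r > 0 let C_r be the arc {−r e^{iθ} : 1/r ≤ θ ≤ π − 1/r} in the open lower half-plane. Then the integral of |f(z) g(z)| with respect to arc length along C_r, namely r ∫_{1/r}^{π−1/r} |f(−r e^{iθ}) g(−r e^{iθ})| dθ, tends to 0 as r → ∞. -/
open MeasureTheory Filter

/-- The value of a holomorphic function at the centre of a circle, squared, is at most the
average of its squared norm over the circle. -/
lemma enorm_sq_le_lintegral_circle {f : ℂ → ℂ} {c : ℂ} {R ρ : ℝ}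
    (hf : DifferentiableOn ℂ f (Metric.ball c R)) (hρ : 0 < ρ) (hρR : ρ < R) :
    ENNReal.ofReal (2 * Real.pi) * ‖f c‖ₑ ^ 2 ≤
      ∫⁻ θ in Set.Ioo (-Real.pi) Real.pi, ‖f (circleMap c ρ θ)‖ₑ ^ 2 := by
  have hsub : Metric.closedBall c ρ ⊆ Metric.ball c R := Metric.closedBall_subset_ball hρR
  have hd : DiffContOnCl ℂ (fun z => f z ^ 2) (Metric.ball c |ρ|) := by
    rw [abs_of_pos hρ]
    exact ((hf.mono hsub).pow 2).diffContOnCl_ball subset_rfl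
  have havg := hd.circleAverage
  have hper : Function.Periodic (fun θ => f (circleMap c ρ θ) ^ 2) (2 * Real.pi) := fun θ => by
    simp only [periodic_circleMap c ρ θ]
  have hshift := hper.intervalIntegral_add_eq 0 (-Real.pi)
  rw [zero_add, show -Real.pi + 2 * Real.pi = Real.pi by ring] at hshift
  have hmean : (2 * Real.pi) • f c ^ 2 =
      ∫ θ in Set.Ioo (-Real.pi) Real.pi, f (circleMap c ρ θ) ^ 2 := by
    rw [← integral_Ioc_eq_integral_Ioo,
      ← intervalIntegral.integral_of_le (by linarith [Real.pi_pos]), ← hshift, ← havg,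
      Real.circleAverage_def, smul_smul, mul_inv_cancel₀ Real.two_pi_pos.ne', one_smul]
  calc ENNReal.ofReal (2 * Real.pi) * ‖f c‖ₑ ^ 2 = ‖(2 * Real.pi) • f c ^ 2‖ₑ := by
        rw [enorm_smul, enorm_pow, Real.enorm_of_nonneg Real.two_pi_pos.le]
    _ ≤ ∫⁻ θ in Set.Ioo (-Real.pi) Real.pi, ‖f (circleMap c ρ θ) ^ 2‖ₑ := by
        rw [hmean]
        exact enorm_integral_le_lintegral_enorm _
    _ = _ := by simp only [enorm_pow]

/-- The area form of the sub-mean value inequality for the squared norm of a holomorphic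
function. -/
lemma enorm_sq_le_lintegral_ball {f : ℂ → ℂ} {c : ℂ} {R : ℝ}
    (hf : DifferentiableOn ℂ f (Metric.ball c R)) (hR : 0 < R) :
    ENNReal.ofReal (Real.pi * R ^ 2) * ‖f c‖ₑ ^ 2 ≤
      ∫⁻ z in Metric.ball c R, ‖f z‖ₑ ^ 2 := by
  classical
  set v : ℂ → ENNReal := (Metric.ball c R).indicator fun z => ‖f z‖ₑ ^ 2 with hv
  have hvm : Measurable v := by
    rw [hv, ← Set.piecewise_eq_indicator]
    exact ContinuousOn.measurable_piecewise
      ((ENNReal.continuous_pow 2).comp_continuousOn hf.continuousOn.enorm)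
      continuousOn_const measurableSet_ball
  have hpolar : ∀ p : ℝ × ℝ, c + Complex.polarCoord.symm p = circleMap c p.1 p.2 := fun p => by
    rw [Complex.polarCoord_symm_apply, circleMap, Complex.exp_mul_I]
    push_cast
    ring
  have hmeas : Measurable fun p : ℝ × ℝ => ENNReal.ofReal p.1 * v (circleMap c p.1 p.2) := by
    have : Measurable fun p : ℝ × ℝ => circleMap c p.1 p.2 := by
      unfold circleMap
      fun_prop
    exact (ENNReal.measurable_ofReal.comp measurable_fst).mul (hvm.comp this)
  have hρ : ∫⁻ ρ in Set.Ioo 0 R, ENNReal.ofReal ρ = ENNReal.ofReal (R ^ 2 / 2) := by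
    rw [← ofReal_integral_eq_lintegral_ofReal, ← integral_Ioc_eq_integral_Ioo,
      ← intervalIntegral.integral_of_le hR.le, integral_id]
    · simp
    · exact (continuous_id.integrableOn_Icc (a := 0) (b := R)).mono_set Set.Ioo_subset_Icc_self
    · exact (ae_restrict_mem measurableSet_Ioo).mono fun x hx => hx.1.le
  calc ENNReal.ofReal (Real.pi * R ^ 2) * ‖f c‖ₑ ^ 2
      = ∫⁻ ρ in Set.Ioo 0 R,
          ENNReal.ofReal ρ * (ENNReal.ofReal (2 * Real.pi) * ‖f c‖ₑ ^ 2) := by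
        rw [lintegral_mul_const _ ENNReal.measurable_ofReal, hρ, ← mul_assoc,
          ← ENNReal.ofReal_mul (by positivity)]
        congr 2
        ring
    _ ≤ ∫⁻ ρ in Set.Ioo 0 R, ∫⁻ θ in Set.Ioo (-Real.pi) Real.pi,
          ENNReal.ofReal ρ * v (circleMap c ρ θ) := by
        refine setLIntegral_mono' measurableSet_Ioo fun ρ hρ => ?_
        rw [lintegral_const_mul' _ _ ENNReal.ofReal_ne_top]
        gcongr
        refine (enorm_sq_le_lintegral_circle hf hρ.1 hρ.2).trans_eq ?_
        refine lintegral_congr fun θ => ?_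
        rw [hv, Set.indicator_of_mem]
        simpa [dist_eq_norm, abs_of_pos hρ.1] using hρ.2
    _ ≤ ∫⁻ ρ in Set.Ioi 0, ∫⁻ θ in Set.Ioo (-Real.pi) Real.pi,
          ENNReal.ofReal ρ * v (circleMap c ρ θ) :=
        lintegral_mono_set Set.Ioo_subset_Ioi_self
    _ = ∫⁻ p in polarCoord.target, ENNReal.ofReal p.1 • v (c + Complex.polarCoord.symm p) := by
        simp only [hpolar, smul_eq_mul, polarCoord_target]
        rw [Measure.volume_eq_prod, ← Measure.prod_restrict, lintegral_prod _ hmeas.aemeasurable]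
    _ = ∫⁻ z, v z := by
        rw [Complex.lintegral_comp_polarCoord_symm fun z => v (c + z)]
        exact lintegral_add_left_eq_self v c
    _ = _ := lintegral_indicator measurableSet_ball _

/-- The growth estimate `‖f z‖ ^ 2 = O(1 / |Im z|)` for functions of Hardy class `H²`. -/
lemma HardyBelow.exists_norm_sq_le {f : ℂ → ℂ} (hf : HardyBelow 2 f) :
    ∃ K : ℝ, 0 ≤ K ∧ ∀ z : ℂ, z.im < 0 → ‖f z‖ ^ 2 * (-z.im) ≤ K := by
  obtain ⟨hd, -, M, hM⟩ := hf
  have hM0 : 0 ≤ M := (integral_nonneg fun x => by positivity).trans (hM (-1) (by norm_num)).2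
  refine ⟨4 * M / Real.pi, by positivity, fun z hz => ?_⟩
  set R := -z.im / 2 with hR
  have hR0 : 0 < R := by linarith
  set S : Set (ℝ × ℝ) := Set.univ ×ˢ Set.Ioo (z.im - R) (z.im + R) with hS
  have hball : Metric.ball z R ⊆ Complex.measurableEquivRealProd ⁻¹' S := fun w hw => by
    have h1 : |w.im - z.im| < R := by
      rw [← Complex.sub_im]
      exact (Complex.abs_im_le_norm _).trans_lt (by simpa [dist_eq_norm] using hw)
    rw [abs_lt] at h1
    simp only [hS, Set.mem_preimage, Complex.measurableEquivRealProd_apply, Set.mem_prod,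
      Set.mem_univ, true_and, Set.mem_Ioo]
    constructor <;> linarith
  have hlow : ∀ p ∈ S, (Complex.measurableEquivRealProd.symm p).im < 0 := fun p hp => by
    have := hp.2.2
    simp only [Complex.measurableEquivRealProd_symm_apply]
    linarith
  have hdb : DifferentiableOn ℂ f (Metric.ball z R) := hd.mono fun w hw => by
    simpa using hlow _ (hball hw)
  have hmS : MeasurableSet S := MeasurableSet.univ.prod measurableSet_Ioo
  have hcont : ContinuousOn (fun p => ‖f (Complex.measurableEquivRealProd.symm p)‖ₑ ^ 2) S := by
    refine (ENNReal.continuous_pow 2).comp_continuousOn (ContinuousOn.enorm ?_)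
    exact hd.continuousOn.comp
      Complex.equivRealProdCLM.symm.continuous.continuousOn hlow
  have hline : ∀ y < 0, ∫⁻ x : ℝ, ‖f (Complex.measurableEquivRealProd.symm (x, y))‖ₑ ^ 2 ≤
      ENNReal.ofReal M := fun y hy => by
    refine le_trans (le_of_eq ?_) (ENNReal.ofReal_le_ofReal (hM y hy).2)
    rw [ofReal_integral_eq_lintegral_ofReal (hM y hy).1
      (Eventually.of_forall fun x => by positivity)]
    refine lintegral_congr fun x => ?_
    rw [Real.rpow_two, ENNReal.ofReal_pow (norm_nonneg _), ofReal_norm,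
      Complex.measurableEquivRealProd_symm_apply, Complex.mk_eq_add_mul_I]
  have hupper : ∫⁻ w in Metric.ball z R, ‖f w‖ₑ ^ 2 ≤ ENNReal.ofReal (2 * R * M) := by
    calc ∫⁻ w in Metric.ball z R, ‖f w‖ₑ ^ 2
        ≤ ∫⁻ w in Complex.measurableEquivRealProd ⁻¹' S, ‖f w‖ₑ ^ 2 := lintegral_mono_set hball
      _ = ∫⁻ p in S, ‖f (Complex.measurableEquivRealProd.symm p)‖ₑ ^ 2 := by
          rw [← Complex.volume_preserving_equiv_real_prod.setLIntegral_comp_preimage_emb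
            Complex.measurableEquivRealProd.measurableEmbedding]
          simp only [MeasurableEquiv.symm_apply_apply]
      _ = ∫⁻ y in Set.Ioo (z.im - R) (z.im + R),
            ∫⁻ x : ℝ, ‖f (Complex.measurableEquivRealProd.symm (x, y))‖ₑ ^ 2 := by
          have := hcont.aemeasurable (μ := volume) hmS
          rw [hS, Measure.volume_eq_prod, ← Measure.prod_restrict] at this ⊢
          rw [lintegral_prod_symm _ this, Measure.restrict_univ]
      _ ≤ ∫⁻ _ in Set.Ioo (z.im - R) (z.im + R), ENNReal.ofReal M :=
          setLIntegral_mono' measurableSet_Ioo fun y hy => hline y (by linarith [hy.2])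
      _ = ENNReal.ofReal (2 * R * M) := by
          rw [setLIntegral_const, Real.volume_Ioo, mul_comm,
            ← ENNReal.ofReal_mul (by linarith)]
          congr 1
          ring
  have key := (enorm_sq_le_lintegral_ball hdb hR0).trans hupper
  rw [← ofReal_norm, ← ENNReal.ofReal_pow (norm_nonneg _), ← ENNReal.ofReal_mul (by positivity),
    ENNReal.ofReal_le_ofReal_iff (by positivity)] at key
  rw [le_div_iff₀ Real.pi_pos]
  have : R * (‖f z‖ ^ 2 * (-z.im) * Real.pi) ≤ R * (4 * M) := by
    have : -z.im = 2 * R := by rw [hR]; ring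
    rw [this]
    nlinarith
  exact le_of_mul_le_mul_left this hR0

lemma norm_sq_sub_one_of_norm_eq_one {w : ℂ} (hw : ‖w‖ = 1) : ‖w ^ 2 - 1‖ = 2 * |w.im| := by
  have h : w ^ 2 - 1 = w * (w - (starRingEnd ℂ) w) := by
    rw [mul_sub, Complex.mul_conj, Complex.normSq_eq_norm_sq, hw]
    push_cast
    ring
  rw [h, norm_mul, hw, one_mul, Complex.sub_conj, norm_mul, Complex.norm_I, mul_one,
    Complex.norm_real, Real.norm_eq_abs, abs_mul, abs_two]

/-- A function of Hardy class `H²` with bounded boundary values is bounded. -/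
lemma HardyBelow.exists_norm_le_s6 {f : ℂ → ℂ} (hf : HardyBelow 2 f) {A : ℝ}
    (hA : ∀ x : ℝ, ‖f x‖ ≤ A) : ∃ B : ℝ, ∀ z : ℂ, z.im ≤ 0 → ‖f z‖ ≤ B := by
  obtain ⟨K, hK0, hK⟩ := hf.exists_norm_sq_le
  obtain ⟨hd, hc, -⟩ := hf
  have hA0 : 0 ≤ A := (norm_nonneg _).trans (hA 0)
  refine ⟨A + (2 * K + 1), fun z hz => ?_⟩
  rcases le_or_gt z.im (-1 / 2) with hlow | hhigh
  · have := hK z (by linarith)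
    nlinarith [sq_nonneg (‖f z‖ - 1), norm_nonneg (f z), sq_nonneg ‖f z‖]
  set U : Set ℂ := Metric.ball (z.re : ℂ) 1 ∩ {w | w.im < 0} with hU
  set F : ℂ → ℂ := fun w => f w * ((w - z.re) ^ 2 - 1) with hF
  have hclU : closure U ⊆ Metric.closedBall (z.re : ℂ) 1 ∩ {w | w.im ≤ 0} := by
    refine closure_minimal (Set.inter_subset_inter Metric.ball_subset_closedBall
      fun w (hw : w.im < 0) => hw.le) (Metric.isClosed_closedBall.inter ?_)
    exact isClosed_le Complex.continuous_im continuous_const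
  have hopen : IsOpen U :=
    Metric.isOpen_ball.inter (isOpen_lt Complex.continuous_im continuous_const)
  have hpoly : Differentiable ℂ fun w : ℂ => (w - z.re) ^ 2 - 1 := by fun_prop
  have hFd : DiffContOnCl ℂ F U :=
    ⟨(hd.mono fun w hw => hw.2).mul hpoly.differentiableOn,
      (hc.mono fun w hw => (hclU hw).2).mul hpoly.continuous.continuousOn⟩
  have hfr : ∀ w ∈ frontier U, ‖F w‖ ≤ A + (2 * K + 1) := fun w hw => by
    rw [hopen.frontier_eq] at hw
    obtain ⟨hw1, hw2⟩ := hclU hw.1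
    rw [mem_closedBall_iff_norm] at hw1
    change w.im ≤ 0 at hw2
    have hFn : ‖F w‖ = ‖f w‖ * ‖(w - z.re) ^ 2 - 1‖ := norm_mul _ _
    rcases hw2.lt_or_eq with him | him
    · have hw3 : ‖w - z.re‖ = 1 := by
        refine le_antisymm hw1 (not_lt.1 fun h => hw.2 ⟨?_, him⟩)
        rwa [mem_ball_iff_norm]
      have him1 : |w.im| ≤ 1 := by
        have := (Complex.abs_im_le_norm (w - z.re)).trans hw1
        simpa using this
      rw [hFn, norm_sq_sub_one_of_norm_eq_one hw3, Complex.sub_im, Complex.ofReal_im, sub_zero]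
      rw [abs_of_neg him] at him1 ⊢
      have := hK w him
      nlinarith [mul_nonneg (sq_nonneg (‖f w‖ - 1)) (neg_nonneg.2 him.le)]
    · have hwr : w = (w.re : ℂ) := Complex.ext rfl (by simpa using him)
      have hf1 : ‖f w‖ ≤ A := by
        rw [hwr]
        exact hA _
      have hle : ‖(w - z.re) ^ 2 - 1‖ ≤ 1 := by
        have hsq : (w.re - z.re) ^ 2 ≤ 1 := by
          rw [sq_le_one_iff_abs_le_one]
          refine le_trans ?_ hw1
          rw [← Complex.ofReal_re z.re, ← Complex.sub_re, Complex.ofReal_re]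
          exact Complex.abs_re_le_norm _
        have : (w - z.re) ^ 2 - 1 = (((w.re - z.re) ^ 2 - 1 : ℝ) : ℂ) := by
          rw [hwr]
          push_cast
          simp
        rw [this, Complex.norm_real, Real.norm_eq_abs, abs_le]
        constructor <;> nlinarith [sq_nonneg (w.re - z.re)]
      rw [hFn]
      nlinarith [norm_nonneg (f w), norm_nonneg ((w - z.re) ^ 2 - 1)]
  have hzsub : z - z.re = z.im * Complex.I := by
    linear_combination -Complex.re_add_im z
  rcases hz.lt_or_eq with him | him
  · have hzU : z ∈ U := by
      refine ⟨?_, him⟩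
      rw [mem_ball_iff_norm, hzsub, norm_mul, Complex.norm_I, Complex.norm_real, mul_one,
        Real.norm_eq_abs, abs_of_neg him]
      linarith
    have hb := Complex.norm_le_of_forall_mem_frontier_norm_le
      (Metric.isBounded_ball.subset Set.inter_subset_left) hFd hfr (subset_closure hzU)
    refine le_trans ?_ hb
    have hnorm : ‖(z - z.re) ^ 2 - 1‖ = z.im ^ 2 + 1 := by
      rw [hzsub, mul_pow, Complex.I_sq,
        show (z.im : ℂ) ^ 2 * -1 - 1 = ((-(z.im ^ 2 + 1) : ℝ) : ℂ) by push_cast; ring,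
        Complex.norm_real, norm_neg, Real.norm_of_nonneg (by positivity)]
    rw [hF, norm_mul, hnorm]
    nlinarith [norm_nonneg (f z), sq_nonneg z.im]
  · have hwr : z = (z.re : ℂ) := Complex.ext rfl (by simpa using him)
    have : ‖f z‖ ≤ A := by
      rw [hwr]
      exact hA _
    linarith

/-- A function of Hardy class `H²` with Schwartz boundary values is `O(1 / |z|)` on the closed
lower half-plane. -/
lemma HardyBelow.exists_norm_mul_norm_le {f : ℂ → ℂ} (hf : HardyBelow 2 f)
    (hfS : ∃ φ : SchwartzMap ℝ ℂ, ∀ x : ℝ, f ↑x = φ x) :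
    ∃ C : ℝ, 0 ≤ C ∧ ∀ z : ℂ, z.im ≤ 0 → ‖z‖ * ‖f z‖ ≤ C := by
  obtain ⟨φ, hφ⟩ := hfS
  obtain ⟨A, hA0, hA⟩ := φ.decay 0 0
  obtain ⟨D, hD0, hD⟩ := φ.decay 1 0
  simp only [norm_iteratedFDeriv_zero, pow_zero, one_mul, pow_one, ← hφ] at hA hD
  obtain ⟨B, hB⟩ := hf.exists_norm_le_s6 hA
  obtain ⟨hd, hc, -⟩ := hf
  have hB0 : 0 ≤ B := (norm_nonneg _).trans (hB 0 (by simp))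
  -- For `0 < δ`, Phragmen-Lindelöf applies to `w f(-iw) / (1 + δw)` on the right half-plane.
  have hbound : ∀ δ : ℝ, 0 < δ → ∀ w : ℂ, 0 ≤ w.re →
      ‖w * f (-Complex.I * w)‖ ≤ D * ‖1 + δ * w‖ := fun δ hδ => by
    have hden : ∀ w : ℂ, 0 ≤ w.re → 1 ≤ ‖1 + δ * w‖ ∧ δ * ‖w‖ ≤ ‖1 + δ * w‖ := fun w hw => by
      constructor
      · refine le_trans ?_ (Complex.re_le_norm _)
        simp only [Complex.add_re, Complex.one_re, Complex.re_ofReal_mul]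
        nlinarith
      · rw [← abs_of_pos hδ, ← Real.norm_eq_abs, ← Complex.norm_real, ← norm_mul,
          Complex.norm_real, Real.norm_eq_abs, abs_of_pos hδ]
        refine (sq_le_sq₀ (norm_nonneg _) (norm_nonneg _)).1 ?_
        rw [← Complex.normSq_eq_norm_sq, ← Complex.normSq_eq_norm_sq, Complex.normSq_apply,
          Complex.normSq_apply]
        simp only [Complex.add_re, Complex.one_re, Complex.re_ofReal_mul, Complex.add_im,
          Complex.one_im, Complex.im_ofReal_mul]
        nlinarith [mul_nonneg hδ.le hw]
    have hne : ∀ w : ℂ, 0 ≤ w.re → 1 + δ * w ≠ 0 := fun w hw =>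
      norm_pos_iff.1 (zero_lt_one.trans_le (hden w hw).1)
    set H : ℂ → ℂ := fun w => w * f (-Complex.I * w) / (1 + δ * w) with hH
    have him : ∀ w : ℂ, (-Complex.I * w).im = -w.re := fun w => by simp
    have hHB : ∀ w : ℂ, 0 ≤ w.re → ‖H w‖ ≤ B / δ := fun w hw => by
      have h1 := hden w hw
      have h2 := hB (-Complex.I * w) (by rw [him]; linarith)
      rw [hH, norm_div, norm_mul, div_le_div_iff₀ (by linarith) hδ]
      nlinarith [norm_nonneg w, norm_nonneg (f (-Complex.I * w)),
        mul_le_mul h2 h1.2 (by positivity) hB0]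
    have hHd : DiffContOnCl ℂ H {w | 0 < w.re} := by
      constructor
      · refine DifferentiableOn.div (differentiableOn_id.mul
          (hd.comp (by fun_prop) fun w hw => ?_)) (by fun_prop)
          fun w (hw : 0 < w.re) => hne w hw.le
        simpa using hw
      · rw [Complex.closure_setOfPred_lt_re]
        refine ContinuousOn.div (continuousOn_id.mul
          (hc.comp (by fun_prop) fun w hw => ?_)) (by fun_prop) fun w hw => hne w hw
        simpa using hw
    intro w hw
    have hPL := PhragmenLindelof.right_half_plane_of_bounded_on_real (C := D) hHd
      ⟨1, by norm_num, 0, ?_⟩ ?_ ?_ hw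
    · rwa [hH, norm_div, div_le_iff₀ (zero_lt_one.trans_le (hden w hw).1)] at hPL
    · refine Asymptotics.IsBigO.of_bound (B / δ) ?_
      filter_upwards [mem_inf_of_right (mem_principal_self _)] with w hw
      simpa using hHB w (le_of_lt hw)
    · exact isBoundedUnder_of_eventually_le (a := B / δ)
        ((eventually_ge_atTop 0).mono fun x hx => hHB x (by simpa using hx))
    · intro x
      have h0 : 0 ≤ ((x : ℂ) * Complex.I).re := by simp
      have harg : -Complex.I * (x * Complex.I) = (x : ℂ) := by
        linear_combination -(x : ℂ) * Complex.I_sq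
      rw [hH, norm_div, div_le_iff₀ (zero_lt_one.trans_le (hden _ h0).1), harg, norm_mul,
        norm_mul, Complex.norm_I, mul_one, Complex.norm_real]
      nlinarith [hD x, (hden _ h0).1]
  refine ⟨D, hD0.le, fun z hz => ?_⟩
  have hlim : Tendsto (fun δ : ℝ => D * ‖1 + (δ : ℂ) * (Complex.I * z)‖)
      (nhdsWithin 0 (Set.Ioi 0)) (nhds D) := by
    refine Tendsto.mono_left ?_ nhdsWithin_le_nhds
    exact Continuous.tendsto' (by fun_prop) _ _ (by simp)
  refine ge_of_tendsto hlim ?_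
  filter_upwards [self_mem_nhdsWithin] with δ hδ
  have := hbound δ hδ (Complex.I * z) (by simpa using hz)
  rwa [← mul_assoc, neg_mul, Complex.I_mul_I, neg_neg, one_mul, norm_mul, norm_mul,
    Complex.norm_I, one_mul] at this

/-- If `f, g` are Hardy class from below of order 2 with Schwartz boundary values on
the real axis, then the arc-length integrals of `|f·g|` along the arcs
`C_r = {-r e^{iθ} : 1/r ≤ θ ≤ π - 1/r}` tend to `0` as `r → ∞`. -/
theorem hardyBelow_schwartz_mul_arc_tendsto_zero (f g : ℂ → ℂ)
    (hf : HardyBelow 2 f) (hg : HardyBelow 2 g)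
    (hfS : ∃ φ : SchwartzMap ℝ ℂ, ∀ x : ℝ, f ↑x = φ x)
    (hgS : ∃ ψ : SchwartzMap ℝ ℂ, ∀ x : ℝ, g ↑x = ψ x) :
    Tendsto (fun r : ℝ =>
        r * ∫ θ in (1 / r)..(Real.pi - 1 / r),
          ‖f (-(↑r * Complex.exp (↑θ * Complex.I))) *
            g (-(↑r * Complex.exp (↑θ * Complex.I)))‖)
      atTop (nhds 0) := by
  obtain ⟨C, hC0, hC⟩ := hf.exists_norm_mul_norm_le hfS
  obtain ⟨D, hD0, hD⟩ := hg.exists_norm_mul_norm_le hgS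
  refine squeeze_zero_norm' (a := fun r : ℝ => C * D * Real.pi / r) ?_
    (tendsto_const_nhds.div_atTop tendsto_id)
  filter_upwards [eventually_ge_atTop 1] with r hr
  have hr0 : 0 < r := by linarith
  have hinv : 1 / r ≤ 1 := (div_le_one hr0).2 hr
  have hinv0 : 0 < 1 / r := by positivity
  have hpi := Real.pi_gt_three
  have hle : 1 / r ≤ Real.pi - 1 / r := by linarith
  have hpt : ∀ θ ∈ Set.uIoc (1 / r) (Real.pi - 1 / r),
      ‖‖f (-(↑r * Complex.exp (↑θ * Complex.I))) *
        g (-(↑r * Complex.exp (↑θ * Complex.I)))‖‖ ≤ C * D / r ^ 2 := fun θ hθ => by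
    rw [Set.uIoc_of_le hle] at hθ
    set z : ℂ := -(↑r * Complex.exp (↑θ * Complex.I)) with hz
    have hzn : ‖z‖ = r := by
      rw [hz, norm_neg, norm_mul, Complex.norm_exp_ofReal_mul_I, mul_one, Complex.norm_real,
        Real.norm_of_nonneg hr0.le]
    have hzi : z.im ≤ 0 := by
      rw [hz, Complex.neg_im, Complex.im_ofReal_mul, Complex.exp_ofReal_mul_I_im, neg_nonpos]
      exact mul_nonneg hr0.le
        (Real.sin_nonneg_of_nonneg_of_le_pi (by linarith [hθ.1]) (by linarith [hθ.2]))
    have h1 := hC z hzi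
    have h2 := hD z hzi
    rw [hzn] at h1 h2
    rw [norm_norm, norm_mul, le_div_iff₀ (by positivity)]
    calc ‖f z‖ * ‖g z‖ * r ^ 2 = (r * ‖f z‖) * (r * ‖g z‖) := by ring
      _ ≤ C * D := mul_le_mul h1 h2 (by positivity) hC0
  have hint := intervalIntegral.norm_integral_le_of_norm_le_const hpt
  rw [abs_of_nonneg (by linarith)] at hint
  rw [norm_mul, Real.norm_of_nonneg hr0.le]
  calc r * _ ≤ r * (C * D / r ^ 2 * Real.pi) := by
        refine mul_le_mul_of_nonneg_left (hint.trans ?_) hr0.le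
        exact mul_le_mul_of_nonneg_left (by linarith) (by positivity)
    _ = C * D * Real.pi / r := by field_simp
end

section
/- Let f be Hardy class from below of order 2 and suppose the restriction of f to the real axis is a Schwartz function. Then the function z ↦ z·f(z) is also Hardy class from below of order 2, i.e., it is analytic on the open lower half-plane, continuous on the closed lower half-plane, its restriction to ℝ (namely x ↦ x f(x)) is a Schwartz function, and sup_{y<0} ∫_ℝ |(x+iy) f(x+iy)|² dx < ∞. -/
open MeasureTheory Filter

theorem differentiableOn_intervalIntegral_translate_mul {k : ℂ → ℂ} {ψ : ℝ → ℂ}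
    (hk : DifferentiableOn ℂ k {z : ℂ | z.im < 0}) (hψ : Continuous ψ) (a b : ℝ) :
    DifferentiableOn ℂ (fun z : ℂ => ∫ t in a..b, k (z + t) * ψ t) {z : ℂ | z.im < 0} := by
  have hopen : IsOpen {z : ℂ | z.im < 0} := isOpen_lt Complex.continuous_im continuous_const
  have hmaps : ∀ z : ℂ, z.im < 0 → Continuous fun t : ℝ => k (z + t) := fun z hz =>
    hk.continuousOn.comp_continuous (by fun_prop) fun t => by simpa using hz
  have hk' : ContinuousOn (deriv k) {z : ℂ | z.im < 0} := (hk.deriv hopen).continuousOn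
  intro z₀ hz₀
  obtain ⟨δ, hδ, hball⟩ := Metric.nhds_basis_closedBall.mem_iff.1 (hopen.mem_nhds hz₀)
  have hcont : ContinuousOn (fun q : ℂ × ℝ => deriv k (q.1 + q.2) * ψ q.2)
      (Metric.closedBall z₀ δ ×ˢ Set.uIcc a b) := by
    refine ContinuousOn.mul (hk'.comp (by fun_prop) ?_) (by fun_prop)
    rintro ⟨z, t⟩ ⟨hz, -⟩
    simpa using hball hz
  obtain ⟨C, hC⟩ :=
    ((isCompact_closedBall z₀ δ).prod isCompact_uIcc).exists_bound_of_continuousOn hcont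
  refine (intervalIntegral.hasDerivAt_integral_of_dominated_loc_of_deriv_le
    (F' := fun z t => deriv k (z + t) * ψ t) (bound := fun _ => C)
    (Metric.closedBall_mem_nhds z₀ hδ) ?_ ?_ ?_ ?_ ?_ ?_).2.differentiableAt.differentiableWithinAt
  · filter_upwards [hopen.mem_nhds hz₀] with z hz
    exact ((hmaps z hz).mul hψ).aestronglyMeasurable
  · exact ((hmaps z₀ hz₀).mul hψ).intervalIntegrable _ _
  · refine (Continuous.mul ?_ hψ).aestronglyMeasurable
    exact hk'.comp_continuous (by fun_prop) fun t => by simpa using hz₀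
  · exact Eventually.of_forall fun t ht z hz => hC (z, t) ⟨hz, Set.uIoc_subset_uIcc ht⟩
  · exact intervalIntegrable_const
  · refine Eventually.of_forall fun t _ z hz => HasDerivAt.mul_const ?_ _
    have hzt : (z + t : ℂ) ∈ {z : ℂ | z.im < 0} := by simpa using hball hz
    exact ((hk.differentiableAt (hopen.mem_nhds hzt)).hasDerivAt).comp_add_const z t

/-- If a bounded function on the closed lower half-plane is bounded by `C` on the real axis,
then it is bounded by `C` everywhere. -/
theorem norm_le_of_bounded_lower_half_plane {F : ℂ → ℂ} {B C : ℝ}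
    (hd : DifferentiableOn ℂ F {z : ℂ | z.im < 0}) (hc : Continuous F)
    (hB : ∀ z : ℂ, z.im < 0 → ‖F z‖ ≤ B) (hC : ∀ x : ℝ, ‖F x‖ ≤ C) {z : ℂ} (hz : z.im < 0) :
    ‖F z‖ ≤ C := by
  have him : ∀ w : ℂ, (-Complex.I * w).im = -w.re := fun w => by simp
  have key := PhragmenLindelof.right_half_plane_of_bounded_on_real
    (f := fun w => F (-Complex.I * w)) (C := C) (z := Complex.I * z) ?_ ⟨0, by norm_num, 0, ?_⟩
    ?_ ?_ (by simpa using hz.le)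
  · simpa [← mul_assoc] using key
  · refine ⟨hd.comp (by fun_prop) fun w hw => ?_, by fun_prop⟩
    simpa using hw
  · refine Asymptotics.IsBigO.of_bound B ?_
    filter_upwards [mem_inf_of_right (mem_principal_self _)] with w hw
    simpa using hB (-Complex.I * w) (by simpa using hw)
  · refine isBoundedUnder_of_eventually_le (a := B) ?_
    filter_upwards [eventually_gt_atTop 0] with x hx
    exact hB _ (by simpa using hx)
  · intro x
    have : -Complex.I * (x * Complex.I) = (x : ℂ) := by
      linear_combination (-(x : ℂ)) * Complex.I_mul_I
    simpa [this] using hC x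

theorem intervalIntegral_norm_sq_le_of_continuous {k : ℂ → ℂ} {M A : ℝ}
    (hd : DifferentiableOn ℂ k {z : ℂ | z.im < 0}) (hc : Continuous k)
    (hM : ∀ y : ℝ, y < 0 → ∀ a b : ℝ, a ≤ b → ∫ x in a..b, ‖k (x + y * Complex.I)‖ ^ 2 ≤ M)
    (hA : ∀ a b : ℝ, a ≤ b → ∫ x in a..b, ‖k (x : ℂ)‖ ^ 2 ≤ A)
    {y : ℝ} (hy : y < 0) {a b : ℝ} (hab : a ≤ b) :
    ∫ x in a..b, ‖k (x + y * Complex.I)‖ ^ 2 ≤ A := by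
  set ψ : ℝ → ℂ := fun t => starRingEnd ℂ (k (t + y * Complex.I)) with hψ_def
  have hψ : Continuous ψ := Complex.continuous_conj.comp (by fun_prop)
  set J := ∫ x in a..b, ‖k (x + y * Complex.I)‖ ^ 2 with hJ
  set F : ℂ → ℂ := fun z => ∫ t in a..b, k (z + t) * ψ t with hF
  have hFc : Continuous F :=
    intervalIntegral.continuous_parametric_intervalIntegral_of_continuous' (by fun_prop) a b
  have hbound : ∀ (D x v : ℝ), (∀ a b : ℝ, a ≤ b → ∫ s in a..b, ‖k (s + v * Complex.I)‖ ^ 2 ≤ D) →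
      ‖F (x + v * Complex.I)‖ ≤ (D + J) / 2 := by
    intro D x v hD
    have hshift : ∫ t in a..b, ‖k (x + v * Complex.I + t)‖ ^ 2 ≤ D := by
      have h := hD (a + x) (b + x) (by linarith)
      rw [← intervalIntegral.integral_comp_add_right] at h
      convert h using 6
      push_cast
      ring
    calc ‖F (x + v * Complex.I)‖
        ≤ ∫ t in a..b, ‖k (x + v * Complex.I + t) * ψ t‖ :=
          intervalIntegral.norm_integral_le_integral_norm hab
      _ ≤ ∫ t in a..b, (1 / 2 * ‖k (x + v * Complex.I + t)‖ ^ 2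
            + 1 / 2 * ‖k (t + y * Complex.I)‖ ^ 2) := by
          refine intervalIntegral.integral_mono_on hab
            (Continuous.intervalIntegrable (by fun_prop) _ _)
            (Continuous.intervalIntegrable (by fun_prop) _ _) fun t _ => ?_
          rw [norm_mul, hψ_def, RCLike.norm_conj]
          nlinarith [sq_nonneg (‖k (x + v * Complex.I + t)‖ - ‖k (t + y * Complex.I)‖)]
      _ ≤ (D + J) / 2 := by
          rw [intervalIntegral.integral_add (Continuous.intervalIntegrable (by fun_prop) _ _)
            (Continuous.intervalIntegrable (by fun_prop) _ _),
            intervalIntegral.integral_const_mul, intervalIntegral.integral_const_mul]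
          linarith
  have hle : ‖F (y * Complex.I)‖ ≤ (A + J) / 2 := by
    refine norm_le_of_bounded_lower_half_plane
      (differentiableOn_intervalIntegral_translate_mul hd hψ a b) hFc (B := (M + J) / 2)
      (fun z hz => ?_) (fun x => ?_) (by simpa using hy)
    · simpa using hbound M z.re z.im (hM _ hz)
    · simpa using hbound A x 0 (by simpa using hA)
  have hFy : F (y * Complex.I) = (J : ℂ) := by
    rw [hF, hJ, ← intervalIntegral.integral_ofReal]
    refine intervalIntegral.integral_congr fun t _ => ?_
    simp only [hψ_def, add_comm (y * Complex.I : ℂ), Complex.mul_conj, Complex.normSq_eq_norm_sq]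
  rw [hFy, Complex.norm_real] at hle
  linarith [Real.le_norm_self J]

/-- Interval form of the maximum principle for the `H²` norms on horizontal lines. -/
theorem intervalIntegral_norm_sq_le {h : ℂ → ℂ} {M A : ℝ}
    (hd : DifferentiableOn ℂ h {z : ℂ | z.im < 0}) (hc : ContinuousOn h {z : ℂ | z.im ≤ 0})
    (hM : ∀ y : ℝ, y < 0 → ∀ a b : ℝ, a ≤ b → ∫ x in a..b, ‖h (x + y * Complex.I)‖ ^ 2 ≤ M)
    (hA : ∀ a b : ℝ, a ≤ b → ∫ x in a..b, ‖h (x : ℂ)‖ ^ 2 ≤ A)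
    {y : ℝ} (hy : y < 0) {a b : ℝ} (hab : a ≤ b) :
    ∫ x in a..b, ‖h (x + y * Complex.I)‖ ^ 2 ≤ A := by
  set p : ℂ → ℂ := fun z => z.re + (min z.im 0 : ℝ) * Complex.I with hp
  have hpc : Continuous p := by fun_prop
  have hp_id : ∀ z : ℂ, z.im ≤ 0 → p z = z := fun z hz => by
    simp only [hp, min_eq_left hz, Complex.re_add_im]
  have hline : ∀ y : ℝ, y ≤ 0 → ∀ x : ℝ, p (x + y * Complex.I) = x + y * Complex.I :=
    fun y hy x => hp_id _ (by simpa using hy)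
  have hreal : ∀ x : ℝ, p x = x := fun x => hp_id _ (by simp)
  have key := intervalIntegral_norm_sq_le_of_continuous (k := h ∘ p) (M := M) (A := A)
    (hd.congr fun z hz => congrArg h (hp_id z (le_of_lt hz)))
    (hc.comp_continuous hpc fun z => by simp [hp])
    (fun y hy => by simpa only [Function.comp_apply, hline y hy.le] using hM y hy)
    (by simpa only [Function.comp_apply, hreal] using hA) hy hab
  simpa only [Function.comp_apply, hline y hy.le] using key

theorem norm_mul_le_norm_one_add_mul {ε : ℝ} (hε : 0 ≤ ε) {z : ℂ} (hz : z.im ≤ 0) :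
    ε * ‖z‖ ≤ ‖1 + Complex.I * ε * z‖ := by
  have hεz : 0 ≤ ε * -z.im := mul_nonneg hε (by linarith)
  refine le_of_sq_le_sq ?_ (norm_nonneg _)
  rw [mul_pow, Complex.sq_norm, Complex.sq_norm, Complex.normSq_apply, Complex.normSq_apply]
  simp
  nlinarith

theorem one_le_norm_one_add_mul {ε : ℝ} (hε : 0 ≤ ε) {z : ℂ} (hz : z.im ≤ 0) :
    1 ≤ ‖1 + Complex.I * ε * z‖ := by
  have hεz : 0 ≤ ε * -z.im := mul_nonneg hε (by linarith)
  refine le_trans ?_ (Complex.re_le_norm _)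
  simp
  linarith

theorem intervalIntegral_norm_sq_mono {u v : ℝ → ℂ} {a b c : ℝ} (hab : a ≤ b)
    (hu : Continuous u) (hv : Continuous v) (h : ∀ x ∈ Set.Icc a b, ‖u x‖ ≤ c * ‖v x‖) :
    ∫ x in a..b, ‖u x‖ ^ 2 ≤ c ^ 2 * ∫ x in a..b, ‖v x‖ ^ 2 := by
  rw [← intervalIntegral.integral_const_mul]
  refine intervalIntegral.integral_mono_on hab (Continuous.intervalIntegrable (by fun_prop) _ _)
    (Continuous.intervalIntegrable (by fun_prop) _ _) fun x hx => ?_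
  rw [← mul_pow]
  gcongr
  exact h x hx

theorem intervalIntegral_norm_sq_id_mul_le {f : ℂ → ℂ} {M A : ℝ}
    (hd : DifferentiableOn ℂ f {z : ℂ | z.im < 0}) (hc : ContinuousOn f {z : ℂ | z.im ≤ 0})
    (hM : ∀ y : ℝ, y < 0 → ∀ a b : ℝ, a ≤ b → ∫ x in a..b, ‖f (x + y * Complex.I)‖ ^ 2 ≤ M)
    (hA : ∀ a b : ℝ, a ≤ b → ∫ x in a..b, ‖(x : ℂ) * f x‖ ^ 2 ≤ A)
    {y : ℝ} (hy : y < 0) {a b : ℝ} (hab : a ≤ b) :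
    ∫ x in a..b, ‖(x + y * Complex.I) * f (x + y * Complex.I)‖ ^ 2 ≤ A := by
  have hline : ∀ {g : ℂ → ℂ}, ContinuousOn g {z : ℂ | z.im ≤ 0} → ∀ y : ℝ, y ≤ 0 →
      Continuous fun x : ℝ => g (x + y * Complex.I) := fun hg y hy =>
    hg.comp_continuous (by fun_prop) fun x => by simpa using hy
  have hreal : ∀ {g : ℂ → ℂ}, ContinuousOn g {z : ℂ | z.im ≤ 0} →
      Continuous fun x : ℝ => g x := fun hg =>
    hg.comp_continuous (by fun_prop) fun x => by simp
  have hidc : ContinuousOn (fun z => z * f z) {z : ℂ | z.im ≤ 0} := continuousOn_id.mul hc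
  set C := max |a| |b| + |y| with hC_def
  have hbound : ∀ ε > 0, ∫ x in a..b, ‖(x + y * Complex.I) * f (x + y * Complex.I)‖ ^ 2
      ≤ (1 + ε * C) ^ 2 * A := by
    intro ε hε
    have hne : ∀ z : ℂ, z.im ≤ 0 → 1 + Complex.I * ε * z ≠ 0 := fun z hz =>
      norm_pos_iff.1 (one_pos.trans_le (one_le_norm_one_add_mul hε.le hz))
    set g : ℂ → ℂ := fun z => z / (1 + Complex.I * ε * z) * f z with hg
    have hgd : DifferentiableOn ℂ g {z : ℂ | z.im < 0} :=
      (DifferentiableOn.div (by fun_prop) (by fun_prop) fun z hz => hne z (le_of_lt hz)).mul hd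
    have hgc : ContinuousOn g {z : ℂ | z.im ≤ 0} :=
      (ContinuousOn.div (by fun_prop) (by fun_prop) hne).mul hc
    have hgA := intervalIntegral_norm_sq_le (h := g) (M := ε⁻¹ ^ 2 * M) (A := A) hgd hgc
      (fun y hy a b hab => ?_) (fun a b hab => ?_) hy hab
    · refine (intervalIntegral_norm_sq_mono (c := 1 + ε * C) hab (hline hidc y hy.le)
        (hline hgc y hy.le) fun x hx => ?_).trans (by gcongr)
      have hz : (x + y * Complex.I : ℂ).im ≤ 0 := by simpa using hy.le
      have hxC : ‖(x + y * Complex.I : ℂ)‖ ≤ C := by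
        refine (norm_add_le _ _).trans ?_
        simpa [hC_def] using abs_le_max_abs_abs hx.1 hx.2
      set z : ℂ := x + y * Complex.I
      have hup : ‖1 + Complex.I * ε * z‖ ≤ 1 + ε * C := by
        refine (norm_add_le _ _).trans ?_
        simp only [norm_one, norm_mul, Complex.norm_I, one_mul, Complex.norm_real,
          Real.norm_of_nonneg hε.le]
        gcongr
      have heq : z * f z = (1 + Complex.I * ε * z) * g z := by
        rw [hg, ← mul_assoc, mul_div_cancel₀ _ (hne z hz)]
      rw [heq, norm_mul]
      gcongr
    · refine (intervalIntegral_norm_sq_mono (c := ε⁻¹) hab (hline hgc y hy.le)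
        (hline hc y hy.le) fun x _ => ?_).trans (by gcongr; exact hM y hy a b hab)
      have hz : (x + y * Complex.I : ℂ).im ≤ 0 := by simpa using hy.le
      set z : ℂ := x + y * Complex.I
      simp only [hg, norm_mul, norm_div]
      gcongr
      rw [div_le_iff₀ (norm_pos_iff.2 (hne z hz)), ← div_eq_inv_mul, le_div_iff₀ hε, mul_comm]
      exact norm_mul_le_norm_one_add_mul hε.le hz
    · refine (intervalIntegral_norm_sq_mono (c := 1) hab (hreal hgc)
        (hreal hidc) fun x _ => ?_).trans (by simpa using hA a b hab)
      simp only [hg, norm_mul, norm_div, one_mul]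
      gcongr
      exact div_le_self (norm_nonneg _) (one_le_norm_one_add_mul hε.le (by simp))
  have hlim : Tendsto (fun ε : ℝ => (1 + ε * C) ^ 2 * A) (nhdsWithin 0 (Set.Ioi 0)) (nhds A) :=
    (Continuous.tendsto' (by fun_prop) _ _ (by simp)).mono_left nhdsWithin_le_nhds
  exact ge_of_tendsto hlim (eventually_mem_nhdsWithin.mono hbound)

theorem exists_schwartzMap_eq_ofReal_mul (φ : SchwartzMap ℝ ℂ) :
    ∃ χ : SchwartzMap ℝ ℂ, ∀ x : ℝ, (x : ℂ) * φ x = χ x :=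
  ⟨SchwartzMap.smulLeftCLM ℂ Complex.ofRealCLM φ, fun x => by
    simp [SchwartzMap.smulLeftCLM_apply_apply Complex.ofRealCLM.hasTemperateGrowth]⟩

theorem SchwartzMap.integrable_norm_sq (φ : SchwartzMap ℝ ℂ) :
    Integrable fun x => ‖φ x‖ ^ 2 :=
  (memLp_two_iff_integrable_sq_norm φ.continuous.aestronglyMeasurable).1 (φ.memLp 2)

theorem intervalIntegral_norm_sq_le_integral {u : ℝ → ℂ} (hu : Integrable fun x => ‖u x‖ ^ 2)
    {a b : ℝ} (hab : a ≤ b) : ∫ x in a..b, ‖u x‖ ^ 2 ≤ ∫ x, ‖u x‖ ^ 2 := by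
  rw [intervalIntegral.integral_of_le hab]
  exact setIntegral_le_integral hu (Eventually.of_forall fun x => by positivity)

theorem integrable_and_integral_le_of_intervalIntegral_le {u : ℝ → ℂ} (hu : Continuous u) {A : ℝ}
    (hA : ∀ a b : ℝ, a ≤ b → ∫ x in a..b, ‖u x‖ ^ 2 ≤ A) :
    Integrable (fun x => ‖u x‖ ^ 2) ∧ ∫ x, ‖u x‖ ^ 2 ≤ A := by
  have hev : ∀ᶠ n : ℝ in atTop, ∫ x in (-n)..n, ‖u x‖ ^ 2 ≤ A := by
    filter_upwards [eventually_ge_atTop 0] with n hn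
    exact hA _ _ (by linarith)
  have hint : Integrable fun x => ‖u x‖ ^ 2 :=
    integrable_of_intervalIntegral_norm_bounded A
      (fun n => (Continuous.integrableOn_Icc (by fun_prop)).mono_set Set.Ioc_subset_Icc_self)
      tendsto_neg_atTop_atBot tendsto_id (by simpa using hev)
  exact ⟨hint, le_of_tendsto
    (intervalIntegral_tendsto_integral hint tendsto_neg_atTop_atBot tendsto_id) hev⟩

/-- If `f` is Hardy class from below of order 2 with Schwartz boundary values, then
`z ↦ z·f(z)` is again Hardy class from below of order 2 with Schwartz boundary
values. -/
theorem hardyBelow_mul_id (f : ℂ → ℂ) (hf : HardyBelow 2 f)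
    (hfS : ∃ φ : SchwartzMap ℝ ℂ, ∀ x : ℝ, f ↑x = φ x) :
    HardyBelow 2 (fun z => z * f z) ∧
    ∃ φ : SchwartzMap ℝ ℂ, ∀ x : ℝ, (↑x : ℂ) * f ↑x = φ x := by
  obtain ⟨hd, hc, M, hM⟩ := hf
  obtain ⟨φ, hφ⟩ := hfS
  obtain ⟨χ, hχ⟩ := exists_schwartzMap_eq_ofReal_mul φ
  have hfχ : ∀ x : ℝ, (x : ℂ) * f x = χ x := fun x => by rw [hφ, hχ]
  have hidc : ContinuousOn (fun z => z * f z) {z : ℂ | z.im ≤ 0} := continuousOn_id.mul hc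
  simp only [Real.rpow_two] at hM
  refine ⟨⟨differentiableOn_id.mul hd, hidc, ∫ x, ‖χ x‖ ^ 2, fun y hy => ?_⟩, χ, hfχ⟩
  simp only [Real.rpow_two]
  refine integrable_and_integral_le_of_intervalIntegral_le
    (hidc.comp_continuous (by fun_prop) fun x => by simpa using hy.le) fun a b hab => ?_
  refine intervalIntegral_norm_sq_id_mul_le hd hc (M := M) (fun y hy a b hab => ?_)
    (fun a b hab => ?_) hy hab
  · exact (intervalIntegral_norm_sq_le_integral (hM y hy).1 hab).trans (hM y hy).2
  · simp only [hfχ]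
    exact intervalIntegral_norm_sq_le_integral χ.integrable_norm_sq hab
end
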